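/- arXiv:2308.04634 — 8 statements merged into one kernel-verified Lean document; each statement's English description precedes it below -/
import Mathlib

section
/- Suppose U has a global minimum at 0 with U(0) = 0 and L-Lipschitz gradient, U ∈ C³ with |∇³U(x)⋮(a⊗b⊗c)| ≤ L_H|a||b||c| for all x,a,b,c ∈ ℝ^d, and L^{1/2}γ⁻¹ ≤ 1/10 and γh ≤ 1. Let z = (x,v), z̃ = (x̃,ṽ) ∈ ℝ^{2d}, and suppose Φ : ℝ^{2d} → ℝ^{2d} is a bijective differentiable map such that O_{h/2}(a₂)∘θ_h∘O_{h/2}(a₁)(z) = O_{h/2}(ã₂)∘θ_h∘O_{h/2}(ã₁)(z̃) whenever (ã₁,ã₂) = Φ(a₁,a₂). Then for ξ₁, ξ₂ independent N(0,I_d) random vectors, ‖Law(ξ₁,ξ₂) − Law(Φ(ξ₁,ξ₂))‖_TV ≤ (7/2)·( (γh)^{−3/2} + d^{1/2}·L_H·h³/(γh) )·‖z − z̃‖, where ‖(x,v)‖² = γ²|x|² + |v|². -/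
open Real MeasureTheory

/-- Total variation distance between two measures, `sup_A |μ(A) − ν(A)|` (in `ℝ≥0∞`). -/
noncomputable def tvDist {S : Type*} [MeasurableSpace S] (μ ν : Measure S) : ENNReal :=
  ⨆ (A : Set S) (_ : MeasurableSet A), max (μ A - ν A) (ν A - μ A)

/-- The standard Gaussian measure `N(0, I_d)` on `ℝ^d`, via its Lebesgue density. -/
noncomputable def stdGaussian (d : ℕ) : Measure (EuclideanSpace ℝ (Fin d)) :=
  volume.withDensity fun x =>
    ENNReal.ofReal ((2 * Real.pi) ^ (-(d : ℝ) / 2) * Real.exp (-‖x‖ ^ 2 / 2))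

/-- The half Ornstein–Uhlenbeck step `O_{h/2}(b)(x,v) = (x, e^{−γh/2} v + (1−e^{−γh})^{1/2} b)`. -/
noncomputable def OUhalf {d : ℕ} (γ h : ℝ) (b : EuclideanSpace ℝ (Fin d))
    (z : EuclideanSpace ℝ (Fin d) × EuclideanSpace ℝ (Fin d)) :
    EuclideanSpace ℝ (Fin d) × EuclideanSpace ℝ (Fin d) :=
  (z.1, Real.exp (-(γ * h) / 2) • z.2 + Real.sqrt (1 - Real.exp (-(γ * h))) • b)

/-- The velocity Verlet map `θ_h = θ^{(A)}_{h/2} ∘ θ^{(B)}_h ∘ θ^{(A)}_{h/2}`. -/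
noncomputable def verlet {d : ℕ} (U : EuclideanSpace ℝ (Fin d) → ℝ) (h : ℝ)
    (z : EuclideanSpace ℝ (Fin d) × EuclideanSpace ℝ (Fin d)) :
    EuclideanSpace ℝ (Fin d) × EuclideanSpace ℝ (Fin d) :=
  let z₁ := (z.1 + (h / 2) • z.2, z.2)
  let z₂ := (z₁.1, z₁.2 - h • gradient U z₁.1)
  (z₂.1 + (h / 2) • z₂.2, z₂.2)

theorem det_adjoint_eq {E : Type*} [NormedAddCommGroup E] [InnerProductSpace ℝ E]
    [FiniteDimensional ℝ E] (T : E →ₗ[ℝ] E) :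
    LinearMap.det (LinearMap.adjoint T) = LinearMap.det T := by
  let b := (stdOrthonormalBasis ℝ E)
  rw [← LinearMap.det_toMatrix b.toBasis, ← LinearMap.det_toMatrix b.toBasis,
    LinearMap.toMatrix_adjoint, Matrix.det_conjTranspose]
  simp

theorem sub_one_sub_two_mul_sq_le_log {x : ℝ} (h : |x - 1| ≤ 1 / 2) :
    (x - 1) - 2 * (x - 1) ^ 2 ≤ Real.log x := by
  obtain ⟨h1, h2⟩ := abs_le.1 h
  have hx : 0 < x := by linarith
  have h3 := Real.one_sub_inv_le_log_of_pos hx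
  refine le_trans ?_ h3
  have : 1 - x⁻¹ = (x - 1) / x := by field_simp
  rw [this, le_div_iff₀ hx]
  nlinarith [sq_nonneg (x - 1)]

/-- Trace minus log-determinant of a small perturbation of the identity is of second order. -/
theorem sum_inner_sub_log_abs_det_one_add_le {E : Type*}
    [NormedAddCommGroup E] [InnerProductSpace ℝ E] [FiniteDimensional ℝ E] {d : ℕ}
    (e : OrthonormalBasis (Fin d) ℝ E) (A : E →L[ℝ] E) (hA : ‖A‖ ≤ 1 / 100) :
    (1 + A).det ≠ 0 ∧
      ∑ i, inner ℝ (e i) (A (e i)) - Real.log |(1 + A).det| ≤ 5 * d * ‖A‖ ^ 2 := by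
  set T : E →ₗ[ℝ] E := ((1 + A : E →L[ℝ] E) : E →ₗ[ℝ] E)
  have hT (x : E) : T x = x + A x := rfl
  set S : E →ₗ[ℝ] E := LinearMap.adjoint T * T
  have hS : S.IsSymmetric := by
    intro x y
    simp only [S, Module.End.mul_apply, LinearMap.adjoint_inner_left, LinearMap.adjoint_inner_right]
  have hn : Module.finrank ℝ E = d := by
    rw [Module.finrank_eq_card_basis e.toBasis, Fintype.card_fin]
  have hSS (x : E) : inner ℝ x (S x) = ‖T x‖ ^ 2 := by
    simp only [S, Module.End.mul_apply, LinearMap.adjoint_inner_right, real_inner_self_eq_norm_sq]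
  have hdet : LinearMap.det S = T.det ^ 2 := by
    rw [map_mul, det_adjoint_eq, sq]
  set l := hS.eigenvalues hn
  have hl (i) : |l i - 1| ≤ 201 / 100 * ‖A‖ := by
    have hv := hS.apply_eigenvectorBasis hn i
    set v := hS.eigenvectorBasis hn i
    have hv1 : ‖v‖ = 1 := (hS.eigenvectorBasis hn).orthonormal.1 i
    have h1 : inner ℝ v (S v) = l i := by
      rw [hv, inner_smul_right, real_inner_self_eq_norm_sq, hv1]; simp [l]
    rw [hSS, hT, norm_add_sq_real, hv1] at h1
    have h2 : ‖A v‖ ≤ ‖A‖ := by simpa [hv1] using A.le_opNorm v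
    have h3 : |inner ℝ v (A v)| ≤ ‖A‖ := by
      have := abs_real_inner_le_norm v (A v)
      rw [hv1] at this; linarith
    obtain ⟨h4, h5⟩ := abs_le.1 h3
    rw [← h1, abs_le]
    constructor <;> nlinarith [norm_nonneg (A v), norm_nonneg A]
  have hpos (i) : 0 < l i := by
    have := (abs_le.1 (hl i)).1
    linarith
  have hprod : T.det ^ 2 = ∏ i, l i := by
    rw [← hdet, hS.det_eq_prod_eigenvalues hn]; simp [l]
  have hne : T.det ≠ 0 := by
    intro h0
    have := Finset.prod_pos (s := Finset.univ) fun i _ => hpos i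
    rw [← hprod, h0] at this; norm_num at this
  have hdet' : (1 + A : E →L[ℝ] E).det = T.det := rfl
  refine ⟨by rwa [hdet'], ?_⟩
  rw [hdet']
  have hlog : 2 * Real.log |T.det| = ∑ i, Real.log (l i) := by
    rw [Real.log_abs, ← Real.log_prod fun i _ => (hpos i).ne', ← hprod, Real.log_pow]; simp
  have htr : ∑ i, l i = ∑ i, ‖T (e i)‖ ^ 2 := by
    have h1 := hS.trace_eq_sum_eigenvalues hn
    rw [LinearMap.trace_eq_sum_inner S e] at h1
    simp only [hSS] at h1
    exact h1.symm
  have h1 : ∑ i, (1 + 2 * inner ℝ (e i) (A (e i))) ≤ ∑ i, l i := by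
    rw [htr]
    refine Finset.sum_le_sum fun i _ => ?_
    rw [hT, norm_add_sq_real, e.orthonormal.1 i]
    nlinarith [sq_nonneg ‖A (e i)‖]
  have h2 : ∑ i, ((l i - 1) - 2 * (201 / 100 * ‖A‖) ^ 2) ≤ ∑ i, Real.log (l i) := by
    refine Finset.sum_le_sum fun i _ => ?_
    have h3 := sub_one_sub_two_mul_sq_le_log (x := l i) ((hl i).trans (by linarith))
    have h4 := sq_le_sq' (by have := abs_nonneg (l i - 1); linarith [hl i]) (hl i)
    rw [sq_abs] at h4
    linarith
  rw [← hlog] at h2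
  simp only [Finset.sum_add_distrib, Finset.sum_sub_distrib, ← Finset.mul_sum, Finset.sum_const,
    Finset.card_univ, Fintype.card_fin, nsmul_eq_mul] at h1 h2
  nlinarith [mul_nonneg (Nat.cast_nonneg (α := ℝ) d) (sq_nonneg ‖A‖)]

/-- The Lebesgue density of `stdGaussian d`. -/
noncomputable def stdGaussianDensity (d : ℕ) (x : EuclideanSpace ℝ (Fin d)) : ℝ :=
  (2 * Real.pi) ^ (-(d : ℝ) / 2) * Real.exp (-‖x‖ ^ 2 / 2)

theorem stdGaussianDensity_pos (d : ℕ) (x : EuclideanSpace ℝ (Fin d)) :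
    0 < stdGaussianDensity d x := by
  unfold stdGaussianDensity; positivity

theorem continuous_stdGaussianDensity (d : ℕ) : Continuous (stdGaussianDensity d) := by
  unfold stdGaussianDensity; fun_prop

theorem hasFDerivAt_stdGaussianDensity (d : ℕ) (x : EuclideanSpace ℝ (Fin d)) :
    HasFDerivAt (stdGaussianDensity d) (-(stdGaussianDensity d x) • innerSL ℝ x) x := by
  have h1 : HasFDerivAt (fun y : EuclideanSpace ℝ (Fin d) => ‖y‖ ^ 2) (2 • innerSL ℝ x) x :=
    (hasStrictFDerivAt_norm_sq x).hasFDerivAt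
  have h2 : HasFDerivAt (fun y : EuclideanSpace ℝ (Fin d) => -‖y‖ ^ 2 / 2)
      ((-(1 / 2 : ℝ)) • (2 • innerSL ℝ x)) x := by
    have h := h1.const_mul (-(1 / 2 : ℝ))
    have hfun : (fun y : EuclideanSpace ℝ (Fin d) => -(1 / 2 : ℝ) * ‖y‖ ^ 2)
        = fun y => -‖y‖ ^ 2 / 2 := by ext y; ring
    rwa [hfun] at h
  have h3 := h2.exp.const_mul ((2 * Real.pi) ^ (-(d : ℝ) / 2))
  refine h3.congr_fderiv ?_
  ext y
  simp [stdGaussianDensity]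
  ring

theorem stdGaussian_eq_withDensity (d : ℕ) :
    stdGaussian d = volume.withDensity fun x => ENNReal.ofReal (stdGaussianDensity d x) := rfl

theorem integrable_exp_neg_mul_norm_sq (d : ℕ) {b : ℝ} (hb : 0 < b) :
    Integrable fun x : EuclideanSpace ℝ (Fin d) => Real.exp (-b * ‖x‖ ^ 2) := by
  have h := (GaussianFourier.integrable_cexp_neg_mul_sq_norm_add (b := (b : ℂ))
    (V := EuclideanSpace ℝ (Fin d)) (by simpa using hb) 0 0).re
  refine h.congr (Filter.Eventually.of_forall fun x => ?_)
  have : (-(b : ℂ) * (‖x‖ : ℂ) ^ 2 + 0 * ((inner ℝ (0 : EuclideanSpace ℝ (Fin d)) x : ℝ) : ℂ))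
      = ((-b * ‖x‖ ^ 2 : ℝ) : ℂ) := by push_cast; ring
  simp only [this]
  exact Complex.exp_ofReal_re _

instance isProbabilityMeasure_stdGaussian (d : ℕ) : IsProbabilityMeasure (stdGaussian d) := by
  constructor
  have hdens : Integrable (stdGaussianDensity d) := by
    refine ((integrable_exp_neg_mul_norm_sq d (b := 1 / 2) (by norm_num)).const_mul
      ((2 * Real.pi) ^ (-(d : ℝ) / 2))).congr (Filter.Eventually.of_forall fun x => ?_)
    simp only [stdGaussianDensity]
    congr 2; ring
  rw [stdGaussian_eq_withDensity, withDensity_apply _ MeasurableSet.univ, Measure.restrict_univ,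
    ← ofReal_integral_eq_lintegral_ofReal hdens
      (Filter.Eventually.of_forall fun x => (stdGaussianDensity_pos d x).le)]
  have h1 : ∫ x, stdGaussianDensity d x
      = (2 * Real.pi) ^ (-(d : ℝ) / 2) * ∫ x : EuclideanSpace ℝ (Fin d),
        Real.exp (-(1 / 2) * ‖x‖ ^ 2) := by
    rw [← integral_const_mul]
    congr 1; ext x
    simp only [stdGaussianDensity]
    congr 2; ring
  rw [h1, GaussianFourier.integral_rexp_neg_mul_sq_norm (by norm_num)]
  have h2 : Real.pi / (1 / 2) = 2 * Real.pi := by ring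
  rw [h2, ← Real.rpow_add (by positivity), finrank_euclideanSpace_fin,
    show -(d : ℝ) / 2 + (d : ℝ) / 2 = 0 by ring]
  simp

theorem integrable_stdGaussian_iff {d : ℕ} {g : EuclideanSpace ℝ (Fin d) → ℝ} :
    Integrable g (stdGaussian d) ↔ Integrable fun x => stdGaussianDensity d x * g x := by
  rw [stdGaussian_eq_withDensity, integrable_withDensity_iff_integrable_smul'
    (continuous_stdGaussianDensity d).measurable.ennreal_ofReal (by simp)]
  simp [ENNReal.toReal_ofReal (stdGaussianDensity_pos d _).le]

theorem integral_stdGaussian {d : ℕ} (g : EuclideanSpace ℝ (Fin d) → ℝ) :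
    ∫ x, g x ∂(stdGaussian d) = ∫ x, stdGaussianDensity d x * g x := by
  rw [stdGaussian_eq_withDensity, integral_withDensity_eq_integral_toReal_smul
    (continuous_stdGaussianDensity d).measurable.ennreal_ofReal (by simp)]
  simp [ENNReal.toReal_ofReal (stdGaussianDensity_pos d _).le]

theorem integrable_norm_stdGaussian (d : ℕ) :
    Integrable (fun x => ‖x‖) (stdGaussian d) := by
  rw [integrable_stdGaussian_iff]
  refine ((integrable_exp_neg_mul_norm_sq d (b := 1 / 4) (by norm_num)).const_mul
      ((2 * Real.pi) ^ (-(d : ℝ) / 2))).mono'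
    ((continuous_stdGaussianDensity d).mul continuous_norm).aestronglyMeasurable
    (Filter.Eventually.of_forall fun x => ?_)
  rw [Real.norm_of_nonneg (mul_nonneg (stdGaussianDensity_pos d x).le (norm_nonneg x)),
    stdGaussianDensity, mul_assoc]
  gcongr
  have h1 : ‖x‖ ≤ Real.exp (‖x‖ ^ 2 / 4) := by
    have := Real.add_one_le_exp (‖x‖ ^ 2 / 4)
    nlinarith [sq_nonneg (‖x‖ / 2 - 1)]
  calc Real.exp (-‖x‖ ^ 2 / 2) * ‖x‖ ≤ Real.exp (-‖x‖ ^ 2 / 2) * Real.exp (‖x‖ ^ 2 / 4) := by gcongr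
    _ = Real.exp (-(1 / 4) * ‖x‖ ^ 2) := by rw [← Real.exp_add]; congr 1; ring

theorem integrable_inner_stdGaussian {d : ℕ}
    {w : EuclideanSpace ℝ (Fin d) → EuclideanSpace ℝ (Fin d)} (hw : Measurable w) {C : ℝ}
    (hC : ∀ x, ‖w x‖ ≤ C) : Integrable (fun x => inner ℝ x (w x)) (stdGaussian d) := by
  refine ((integrable_norm_stdGaussian d).const_mul C).mono'
    (measurable_id.inner hw).aestronglyMeasurable (Filter.Eventually.of_forall fun x => ?_)
  refine (norm_inner_le_norm _ _).trans ?_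
  rw [mul_comm]
  gcongr
  exact hC x

/-- One coordinate of Stein's identity. -/
theorem integral_stdGaussian_inner_mul_eq {d : ℕ} {g : EuclideanSpace ℝ (Fin d) → ℝ}
    (hg : Differentiable ℝ g) {C C' : ℝ} (hC : ∀ x, ‖g x‖ ≤ C) (hC' : ∀ x, ‖fderiv ℝ g x‖ ≤ C')
    (v : EuclideanSpace ℝ (Fin d)) :
    Integrable (fun x => inner ℝ x v * g x) (stdGaussian d) ∧
    Integrable (fun x => fderiv ℝ g x v) (stdGaussian d) ∧
    ∫ x, inner ℝ x v * g x ∂(stdGaussian d) = ∫ x, fderiv ℝ g x v ∂(stdGaussian d) := by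
  have hgm : Measurable g := hg.continuous.measurable
  have i1 : Integrable (fun x => inner ℝ x v * g x) (stdGaussian d) := by
    have := integrable_inner_stdGaussian (w := fun x => g x • v) (hgm.smul_const v)
      (C := C * ‖v‖) (fun x => by rw [norm_smul]; gcongr; exact hC x)
    refine this.congr (Filter.Eventually.of_forall fun x => ?_)
    simp only [inner_smul_right]; ring
  have i2 : Integrable (fun x => fderiv ℝ g x v) (stdGaussian d) := by
    refine Integrable.of_bound (measurable_fderiv_apply_const ℝ g v).aestronglyMeasurable (C' * ‖v‖)
      (Filter.Eventually.of_forall fun x => ?_)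
    exact (ContinuousLinearMap.le_opNorm _ _).trans (by gcongr; exact hC' x)
  have i3 : Integrable g (stdGaussian d) :=
    Integrable.of_bound hgm.aestronglyMeasurable C (Filter.Eventually.of_forall hC)
  refine ⟨i1, i2, ?_⟩
  rw [integrable_stdGaussian_iff] at i1 i2 i3
  rw [integral_stdGaussian, integral_stdGaussian]
  have hψ (x) : fderiv ℝ (stdGaussianDensity d) x v = -(stdGaussianDensity d x * inner ℝ x v) := by
    rw [(hasFDerivAt_stdGaussianDensity d x).fderiv]
    simp
  have := integral_mul_fderiv_eq_neg_fderiv_mul_of_integrable (μ := volume)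
    (f := stdGaussianDensity d) (g := g) (v := v)
    (by
      refine i1.neg.congr (Filter.Eventually.of_forall fun x => ?_)
      simp only [hψ, Pi.neg_apply]; ring) i2 i3
    (fun x _ => (hasFDerivAt_stdGaussianDensity d x).differentiableAt) (fun x _ => hg x)
  rw [this, ← integral_neg]
  congr 1; ext x
  rw [hψ]; ring

/-- **Stein's identity**: `x ⬝ w x - div w` is centred under the standard Gaussian measure. -/
theorem stdGaussian_stein {d : ℕ} {w : EuclideanSpace ℝ (Fin d) → EuclideanSpace ℝ (Fin d)}
    (hw : Differentiable ℝ w) {C C' : ℝ} (hC : ∀ x, ‖w x‖ ≤ C) (hC' : ∀ x, ‖fderiv ℝ w x‖ ≤ C') :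
    Integrable (fun x => inner ℝ x (w x) - ∑ i, inner ℝ (EuclideanSpace.basisFun (Fin d) ℝ i)
      (fderiv ℝ w x (EuclideanSpace.basisFun (Fin d) ℝ i))) (stdGaussian d) ∧
    ∫ x, (inner ℝ x (w x) - ∑ i, inner ℝ (EuclideanSpace.basisFun (Fin d) ℝ i)
      (fderiv ℝ w x (EuclideanSpace.basisFun (Fin d) ℝ i))) ∂(stdGaussian d) = 0 := by
  set e := EuclideanSpace.basisFun (Fin d) ℝ
  have hd (i x) : HasFDerivAt (fun y => inner ℝ (e i) (w y))
      ((innerSL ℝ (e i)).comp (fderiv ℝ w x)) x :=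
    (innerSL ℝ (e i)).hasFDerivAt.comp x (hw x).hasFDerivAt
  have hn (i) : ‖innerSL ℝ (e i)‖ = 1 := by rw [innerSL_apply_norm]; exact e.orthonormal.1 i
  have key (i) := integral_stdGaussian_inner_mul_eq (g := fun y => inner ℝ (e i) (w y))
    (fun x => (hd i x).differentiableAt) (C := C) (C' := C')
    (fun x => (norm_inner_le_norm _ _).trans (by rw [e.orthonormal.1 i, one_mul]; exact hC x))
    (fun x => by
      rw [(hd i x).fderiv]
      refine (ContinuousLinearMap.opNorm_comp_le _ _).trans ?_
      rw [hn, one_mul]; exact hC' x) (e i)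
  have hf (i x) : fderiv ℝ (fun y => inner ℝ (e i) (w y)) x (e i)
      = inner ℝ (e i) (fderiv ℝ w x (e i)) := by
    rw [(hd i x).fderiv]; rfl
  simp only [hf] at key
  have heq : (fun x => inner ℝ x (w x) - ∑ i, inner ℝ (e i) (fderiv ℝ w x (e i)))
      = fun x => ∑ i, (inner ℝ x (e i) * inner ℝ (e i) (w x)
        - inner ℝ (e i) (fderiv ℝ w x (e i))) := by
    ext x
    rw [Finset.sum_sub_distrib, e.sum_inner_mul_inner]
  rw [heq]
  refine ⟨integrable_finsetSum _ fun i _ => (key i).1.sub (key i).2.1, ?_⟩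
  rw [integral_finsetSum Finset.univ (f := fun i x => inner ℝ x (e i) * inner ℝ (e i) (w x)
    - inner ℝ (e i) (fderiv ℝ w x (e i))) fun i _ => (key i).1.sub (key i).2.1]
  refine Finset.sum_eq_zero fun i _ => ?_
  rw [integral_sub (key i).1 (key i).2.1, (key i).2.2, sub_self]

theorem abs_sub_one_le_of_pos {p c : ℝ} (hp : 0 < p) (hc : 0 < c) :
    |p - 1| ≤ c / 2 * (p - 1 - Real.log p) + (p + 1) / c := by
  have hr : 0 < √p := Real.sqrt_pos.2 hp
  have hp' : p = √p ^ 2 := (Real.sq_sqrt hp.le).symm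
  have hlog : Real.log p = 2 * Real.log √p := by
    conv_lhs => rw [hp', Real.log_pow]
    norm_num
  have h1 := Real.log_le_sub_one_of_pos hr
  set r := √p
  have h2 : (r - 1) ^ 2 ≤ p - 1 - Real.log p := by rw [hlog]; nlinarith
  have h3 : |p - 1| = |r - 1| * (r + 1) := by
    rw [← abs_of_pos (show 0 < r + 1 by linarith), ← abs_mul, hp']; congr 1; ring
  have h4 : c / 2 * (r - 1) ^ 2 + (p + 1) / c - |p - 1|
      = ((c * |r - 1| - (r + 1)) ^ 2 + (r - 1) ^ 2) / (2 * c) := by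
    have hm : |r - 1| ^ 2 = (r - 1) ^ 2 := sq_abs _
    rw [h3, hp']
    generalize |r - 1| = m at hm
    field_simp
    linear_combination -c ^ 2 * hm
  have h5 : 0 ≤ ((c * |r - 1| - (r + 1)) ^ 2 + (r - 1) ^ 2) / (2 * c) := by positivity
  have h6 : c / 2 * (r - 1) ^ 2 ≤ c / 2 * (p - 1 - Real.log p) := by gcongr
  linarith

/-- Total variation bound for a change of variables with explicit Jacobian density `p`, in terms of
a bound on the relative entropy `-∫ log p`. -/
theorem tvDist_map_le_of_neg_log_le {S : Type*} [MeasurableSpace S] (ν : Measure S)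
    [IsProbabilityMeasure ν] {Φ : S → S} (hΦ : Measurable Φ) {p s : S → ℝ} (hp : Measurable p)
    (hp0 : ∀ x, 0 < p x)
    (hcov : ∀ B, MeasurableSet B → ν B = ∫⁻ x in Φ ⁻¹' B, ENNReal.ofReal (p x) ∂ν)
    (hs : Integrable s ν) (hs0 : ∫ x, s x ∂ν = 0) {K R : ℝ}
    (hK : ∀ x, -Real.log (p x) ≤ K + s x) (hR : 0 ≤ R) (hKR : 4 * K ≤ R ^ 2) :
    tvDist ν (ν.map Φ) ≤ ENNReal.ofReal R := by
  have hlin : ∫⁻ x, ENNReal.ofReal (p x) ∂ν = 1 := by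
    have := hcov Set.univ MeasurableSet.univ
    simpa using this.symm
  have hpi : Integrable p ν := by
    refine ⟨hp.aestronglyMeasurable, ?_⟩
    rw [hasFiniteIntegral_iff_ofReal (Filter.Eventually.of_forall fun x => (hp0 x).le), hlin]
    simp
  have hp1 : ∫ x, p x ∂ν = 1 := by
    rw [integral_eq_lintegral_of_nonneg_ae (Filter.Eventually.of_forall fun x => (hp0 x).le)
      hp.aestronglyMeasurable, hlin]
    simp
  have hpi1 : Integrable (fun x => p x - 1) ν := hpi.sub (integrable_const 1)
  set I := ∫ x, |p x - 1| ∂ν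
  have hIc (c : ℝ) (hc : 0 < c) : I ≤ c / 2 * K + 2 / c := by
    have hi1 : Integrable (fun x => c / 2 * (p x - 1 + (K + s x))) ν :=
      (hpi1.add ((integrable_const K).add hs)).const_mul _
    have hi2 : Integrable (fun x => (p x + 1) / c) ν := (hpi.add (integrable_const 1)).div_const c
    have h1 : I ≤ ∫ x, (c / 2 * (p x - 1 + (K + s x)) + (p x + 1) / c) ∂ν := by
      refine integral_mono hpi1.abs (hi1.add hi2) fun x => ?_
      refine (abs_sub_one_le_of_pos (hp0 x) hc).trans ?_
      have h2 : p x - 1 - Real.log (p x) ≤ p x - 1 + (K + s x) := by linarith [hK x]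
      gcongr
    refine h1.trans_eq ?_
    have hKs : Integrable (fun x => K + s x) ν := (integrable_const K).add hs
    rw [integral_add hi1 hi2, integral_const_mul, integral_div, integral_add hpi1 hKs,
      integral_sub hpi (integrable_const 1), integral_add
      (integrable_const K) hs, integral_add hpi (integrable_const 1), hp1, hs0]
    simp
    norm_num
  have hIR : I ≤ R := by
    by_contra hlt
    push Not at hlt
    have hI : 0 < I := hR.trans_lt hlt
    have h1 := hIc (4 / I) (by positivity)
    have h2 : 4 / I / 2 * K + 2 / (4 / I) = 2 * K / I + I / 2 := by field_simp; ring
    rw [h2] at h1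
    have h3 : I / 2 ≤ 2 * K / I := by linarith
    rw [le_div_iff₀ hI] at h3
    nlinarith
  have key (A : Set S) (hA : MeasurableSet A) : |ν.real A - (ν.map Φ).real A| ≤ I := by
    have hΦA : MeasurableSet (Φ ⁻¹' A) := hΦ hA
    have h1 : ν.real A = ∫ x in Φ ⁻¹' A, p x ∂ν := by
      rw [integral_eq_lintegral_of_nonneg_ae (Filter.Eventually.of_forall fun x => (hp0 x).le)
        hp.aestronglyMeasurable, ← hcov A hA, Measure.real]
    have h2 : (ν.map Φ).real A = ∫ x in Φ ⁻¹' A, (1 : ℝ) ∂ν := by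
      rw [Measure.real, Measure.map_apply hΦ hA]; simp [Measure.real]
    rw [h1, h2, ← integral_sub hpi.integrableOn (integrable_const 1)]
    refine (abs_integral_le_integral_abs).trans ?_
    exact setIntegral_le_integral hpi1.abs (Filter.Eventually.of_forall fun x => abs_nonneg _)
  have : IsProbabilityMeasure (ν.map Φ) := Measure.isProbabilityMeasure_map hΦ.aemeasurable
  refine iSup₂_le fun A hA => ?_
  obtain ⟨h1, h2⟩ := abs_le.1 ((key A hA).trans hIR)
  refine max_le ?_ ?_ <;>
  · rw [tsub_le_iff_right, ← ENNReal.ofReal_toReal (measure_ne_top ν A),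
      ← ENNReal.ofReal_toReal (measure_ne_top (ν.map Φ) A), ← ENNReal.ofReal_add hR (by positivity)]
    refine ENNReal.ofReal_le_ofReal ?_
    simp only [Measure.real] at h1 h2
    linarith

/-- Change of variables for the standard Gaussian measure. -/
theorem lintegral_stdGaussian_eq_lintegral_comp {d : ℕ}
    {f : EuclideanSpace ℝ (Fin d) → EuclideanSpace ℝ (Fin d)} (hf : Differentiable ℝ f)
    (hb : Function.Bijective f) {g : EuclideanSpace ℝ (Fin d) → ENNReal} (hg : Measurable g) :
    ∫⁻ x, g x ∂(stdGaussian d) = ∫⁻ x, ENNReal.ofReal (|(fderiv ℝ f x).det| *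
      Real.exp ((‖x‖ ^ 2 - ‖f x‖ ^ 2) / 2)) * g (f x) ∂(stdGaussian d) := by
  have hm := (continuous_stdGaussianDensity d).measurable.ennreal_ofReal
  have hdet : Measurable fun x => (fderiv ℝ f x).det :=
    ContinuousLinearMap.continuous_det.measurable.comp (measurable_fderiv ℝ f)
  have hfm : Measurable f := hf.continuous.measurable
  rw [stdGaussian_eq_withDensity, lintegral_withDensity_eq_lintegral_mul _ hm hg,
    lintegral_withDensity_eq_lintegral_mul _ hm (by fun_prop)]
  have h := lintegral_image_eq_lintegral_abs_det_fderiv_mul volume MeasurableSet.univ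
    (fun x _ => (hf x).hasFDerivAt.hasFDerivWithinAt) hb.1.injOn
    (fun x => ENNReal.ofReal (stdGaussianDensity d x) * g x)
  rw [Set.image_univ, hb.2.range_eq, Measure.restrict_univ] at h
  refine h.trans (lintegral_congr fun x => ?_)
  simp only [Pi.mul_apply]
  rw [← mul_assoc, ← mul_assoc, ← ENNReal.ofReal_mul (abs_nonneg _),
    ← ENNReal.ofReal_mul (stdGaussianDensity_pos d x).le]
  congr 2
  have h2 : stdGaussianDensity d (f x)
      = stdGaussianDensity d x * Real.exp ((‖x‖ ^ 2 - ‖f x‖ ^ 2) / 2) := by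
    rw [stdGaussianDensity, stdGaussianDensity, mul_assoc, ← Real.exp_add]
    congr 2; ring
  rw [h2]; ring

/-- The Jacobian density of the map `(a, b) ↦ (f a, b + u a)` with respect to the product of two
standard Gaussian measures. -/
noncomputable def triangularDensity {d : ℕ}
    (f u : EuclideanSpace ℝ (Fin d) → EuclideanSpace ℝ (Fin d))
    (x : EuclideanSpace ℝ (Fin d) × EuclideanSpace ℝ (Fin d)) : ℝ :=
  |(fderiv ℝ f x.1).det| * Real.exp ((‖x.1‖ ^ 2 - ‖f x.1‖ ^ 2) / 2) *
    Real.exp ((‖x.2‖ ^ 2 - ‖x.2 + u x.1‖ ^ 2) / 2)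

theorem measurable_triangularDensity {d : ℕ}
    {f u : EuclideanSpace ℝ (Fin d) → EuclideanSpace ℝ (Fin d)} (hf : Differentiable ℝ f)
    (hu : Measurable u) : Measurable (triangularDensity f u) := by
  have hdet : Measurable fun x : EuclideanSpace ℝ (Fin d) × EuclideanSpace ℝ (Fin d) =>
      |(fderiv ℝ f x.1).det| :=
    (ContinuousLinearMap.continuous_det.abs.measurable.comp (measurable_fderiv ℝ f)).comp
      measurable_fst
  have hfm : Measurable f := hf.continuous.measurable
  unfold triangularDensity
  refine (hdet.mul ?_).mul ?_ <;> fun_prop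

/-- Change of variables for the product of two standard Gaussian measures, under a map which
transforms the first variable and translates the second one by a function of the first. -/
theorem prod_stdGaussian_apply_eq_setLIntegral {d : ℕ}
    {f u : EuclideanSpace ℝ (Fin d) → EuclideanSpace ℝ (Fin d)} (hf : Differentiable ℝ f)
    (hb : Function.Bijective f) (hu : Measurable u)
    {B : Set (EuclideanSpace ℝ (Fin d) × EuclideanSpace ℝ (Fin d))} (hB : MeasurableSet B) :
    ((stdGaussian d).prod (stdGaussian d)) B =
      ∫⁻ x in (fun x => (f x.1, x.2 + u x.1)) ⁻¹' B, ENNReal.ofReal (triangularDensity f u x)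
        ∂((stdGaussian d).prod (stdGaussian d)) := by
  have hfm : Measurable f := hf.continuous.measurable
  have hΦ : Measurable fun x : EuclideanSpace ℝ (Fin d) × EuclideanSpace ℝ (Fin d) =>
    (f x.1, x.2 + u x.1) := by fun_prop
  have hB1 : Measurable (B.indicator
    (1 : EuclideanSpace ℝ (Fin d) × EuclideanSpace ℝ (Fin d) → ENNReal)) :=
    measurable_one.indicator hB
  rw [← lintegral_indicator_one hB, lintegral_prod _ hB1.aemeasurable,
    lintegral_stdGaussian_eq_lintegral_comp hf hb hB1.lintegral_prod_right',
    ← lintegral_indicator (hΦ hB), lintegral_prod _ 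
      ((measurable_triangularDensity hf hu).ennreal_ofReal.indicator (hΦ hB)).aemeasurable]
  refine lintegral_congr fun a => ?_
  rw [lintegral_stdGaussian_eq_lintegral_comp (f := fun b => b + u a) (by fun_prop)
    (AddGroup.addRight_bijective (u a))
      (g := fun y => B.indicator 1 (f a, y)) (hB1.comp measurable_prodMk_left),
    ← lintegral_const_mul' _ _ ENNReal.ofReal_ne_top]
  refine lintegral_congr fun b => ?_
  have h1 : fderiv ℝ (fun b => b + u a) b = ContinuousLinearMap.id ℝ _ := by
    rw [fderiv_add_const, fderiv_fun_id]
  rw [h1, ← mul_assoc, ← ENNReal.ofReal_mul (by positivity)]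
  have h2 : (ContinuousLinearMap.id ℝ (EuclideanSpace ℝ (Fin d))).det = 1 := LinearMap.det_id
  by_cases hmem : (f a, b + u a) ∈ B <;> simp [triangularDensity, Set.indicator, hmem, h2]

/-- Total variation bound for a map `(a, b) ↦ (a + w a, b + u a)` under two independent standard
Gaussian vectors. -/
theorem tvDist_prod_stdGaussian_map_le {d : ℕ}
    {w u : EuclideanSpace ℝ (Fin d) → EuclideanSpace ℝ (Fin d)} (hw : Differentiable ℝ w)
    (hb : Function.Bijective fun a => a + w a) (hu : Measurable u) {Cw Cu ε R : ℝ}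
    (hCw : ∀ a, ‖w a‖ ≤ Cw) (hCu : ∀ a, ‖u a‖ ≤ Cu) (hε : ∀ a, ‖fderiv ℝ w a‖ ≤ ε)
    (hε' : ∀ a, ‖fderiv ℝ w a‖ ≤ 1 / 100) (hR : 0 ≤ R)
    (h : 2 * (Cw ^ 2 + Cu ^ 2) + 20 * d * ε ^ 2 ≤ R ^ 2) :
    tvDist ((stdGaussian d).prod (stdGaussian d))
      (((stdGaussian d).prod (stdGaussian d)).map fun x => (x.1 + w x.1, x.2 + u x.1)) ≤
      ENNReal.ofReal R := by
  set e := EuclideanSpace.basisFun (Fin d) ℝ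
  have hf : Differentiable ℝ fun a => a + w a := by fun_prop
  have hfd (a) : fderiv ℝ (fun a => a + w a) a = 1 + fderiv ℝ w a := by
    rw [fderiv_fun_add differentiableAt_fun_id (hw a), fderiv_fun_id]; rfl
  have hwm : Measurable w := hw.continuous.measurable
  obtain ⟨hs1, hs1'⟩ := stdGaussian_stein hw hCw hε
  have hs2 : Integrable (fun x : EuclideanSpace ℝ (Fin d) × EuclideanSpace ℝ (Fin d) =>
      inner ℝ x.2 (u x.1)) ((stdGaussian d).prod (stdGaussian d)) := by
    refine (((integrable_norm_stdGaussian d).comp_snd (stdGaussian d)).const_mul Cu).mono'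
      (by fun_prop) (Filter.Eventually.of_forall fun x => ?_)
    refine (norm_inner_le_norm _ _).trans ?_
    rw [mul_comm]
    gcongr
    exact hCu _
  have hs2' : ∫ x : EuclideanSpace ℝ (Fin d) × EuclideanSpace ℝ (Fin d),
      inner ℝ x.2 (u x.1) ∂((stdGaussian d).prod (stdGaussian d)) = 0 := by
    rw [integral_prod _ hs2]
    refine integral_eq_zero_of_ae (Filter.Eventually.of_forall fun a => ?_)
    have := (stdGaussian_stein (w := fun _ => u a) (by fun_prop) (fun _ => le_rfl)
      (C' := 0) (fun x => by simp)).2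
    simpa using this
  have hs1p := hs1.comp_fst (stdGaussian d)
  refine tvDist_map_le_of_neg_log_le _ (by fun_prop) (measurable_triangularDensity hf hu) ?_
    (fun B hB => prod_stdGaussian_apply_eq_setLIntegral hf hb hu hB) (hs1p.add hs2) ?_
    (K := (Cw ^ 2 + Cu ^ 2) / 2 + 5 * d * ε ^ 2) ?_ hR (by linarith)
  · intro x
    have := (sum_inner_sub_log_abs_det_one_add_le e _ (hε' x.1)).1
    simp only [triangularDensity, hfd]
    positivity
  · simp only [Pi.add_apply]
    rw [integral_add hs1p hs2, hs2', integral_fun_fst (μ := stdGaussian d) (ν := stdGaussian d)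
      (fun a => inner ℝ a (w a) - ∑ i, inner ℝ (e i) (fderiv ℝ w a (e i))), hs1']
    simp
  · intro x
    obtain ⟨h1, h2⟩ := sum_inner_sub_log_abs_det_one_add_le e _ (hε' x.1)
    have h3 : ‖fderiv ℝ w x.1‖ ^ 2 ≤ ε ^ 2 := by gcongr; exact hε _
    have h4 : ‖w x.1‖ ^ 2 ≤ Cw ^ 2 := by gcongr; exact hCw _
    have h5 : ‖u x.1‖ ^ 2 ≤ Cu ^ 2 := by gcongr; exact hCu _
    have h6 : 5 * (d : ℝ) * ‖fderiv ℝ w x.1‖ ^ 2 ≤ 5 * d * ε ^ 2 := by gcongr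
    simp only [triangularDensity, hfd, Pi.add_apply]
    rw [Real.log_mul (by positivity) (by positivity), Real.log_mul (by positivity) (by positivity),
      Real.log_exp, Real.log_exp, norm_add_sq_real, norm_add_sq_real]
    linarith

section Gradient

variable {E : Type*} [NormedAddCommGroup E] [InnerProductSpace ℝ E] [CompleteSpace E] {U : E → ℝ}

variable (E) in
/-- The inverse of the Riesz isomorphism of a real Hilbert space, as a linear map. -/
noncomputable def rieszInv : StrongDual ℝ E →L[ℝ] E :=
  LinearMap.mkContinuous
    { toFun := (InnerProductSpace.toDual ℝ E).symm
      map_add' := map_add _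
      map_smul' := fun c l => by simp } 1 fun l => by simp

theorem norm_rieszInv (l : StrongDual ℝ E) : ‖rieszInv E l‖ = ‖l‖ :=
  (InnerProductSpace.toDual ℝ E).symm.norm_map l

theorem hasFDerivAt_gradient (hU : ContDiff ℝ 3 U) (x : E) :
    HasFDerivAt (gradient U) ((rieszInv E).comp (fderiv ℝ (fderiv ℝ U) x)) x := by
  have h1 : Differentiable ℝ (fderiv ℝ U) :=
    (hU.fderiv_right (m := 2) (by norm_num)).differentiable (by norm_num)
  exact (rieszInv E).hasFDerivAt.comp x (h1 x).hasFDerivAt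

theorem norm_fderiv_gradient_sub_le (hU : ContDiff ℝ 3 U) {M : ℝ} (hM : 0 ≤ M)
    (hHess : ∀ x a b c : E, |iteratedFDeriv ℝ 3 U x ![a, b, c]| ≤ M * ‖a‖ * ‖b‖ * ‖c‖) (x y : E) :
    ‖fderiv ℝ (gradient U) x - fderiv ℝ (gradient U) y‖ ≤ M * ‖x - y‖ := by
  have h3 (x : E) : ‖fderiv ℝ (iteratedFDeriv ℝ 2 U) x‖ ≤ M := by
    rw [norm_fderiv_iteratedFDeriv]
    refine ContinuousMultilinearMap.opNorm_le_bound hM fun m => ?_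
    have := hHess x (m 0) (m 1) (m 2)
    rw [show ![m 0, m 1, m 2] = m by ext i; fin_cases i <;> rfl] at this
    rw [Fin.prod_univ_three, Real.norm_eq_abs]
    linarith
  have hd : Differentiable ℝ (iteratedFDeriv ℝ 2 U) :=
    hU.differentiable_iteratedFDeriv (by norm_num)
  have h2 : ‖iteratedFDeriv ℝ 2 U x - iteratedFDeriv ℝ 2 U y‖ ≤ M * ‖x - y‖ :=
    Convex.norm_image_sub_le_of_norm_fderiv_le (fun z _ => hd z) (fun z _ => h3 z) convex_univ
      (Set.mem_univ y) (Set.mem_univ x)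
  refine ContinuousLinearMap.opNorm_le_bound _ (by positivity) fun a => ?_
  rw [(hasFDerivAt_gradient hU x).fderiv, (hasFDerivAt_gradient hU y).fderiv]
  simp only [sub_apply, ContinuousLinearMap.comp_apply]
  rw [← map_sub, norm_rieszInv]
  refine ContinuousLinearMap.opNorm_le_bound _ (by positivity) fun b => ?_
  have h4 := (iteratedFDeriv ℝ 2 U x - iteratedFDeriv ℝ 2 U y).le_opNorm ![a, b]
  rw [sub_apply, iteratedFDeriv_two_apply, iteratedFDeriv_two_apply,
    Fin.prod_univ_two] at h4
  simp only [Matrix.cons_val_zero, Matrix.cons_val_one] at h4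
  refine h4.trans ?_
  rw [← mul_assoc]
  gcongr

theorem norm_fderiv_gradient_le {L : ℝ} (hL : 0 ≤ L)
    (hLip : ∀ x y, ‖gradient U x - gradient U y‖ ≤ L * ‖x - y‖) (x : E) :
    ‖fderiv ℝ (gradient U) x‖ ≤ L := by
  have : LipschitzWith ⟨L, hL⟩ (gradient U) :=
    LipschitzWith.of_dist_le_mul fun x y => by
      rw [dist_eq_norm, dist_eq_norm]; exact hLip x y
  exact norm_fderiv_le_of_lipschitz ℝ this

end Gradient

section Step

variable {d : ℕ} (U : EuclideanSpace ℝ (Fin d) → ℝ) (γ h : ℝ)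

/-- The position at which the gradient is evaluated in a step started at `z` with noise `a`. -/
noncomputable def stepMidpoint (z : EuclideanSpace ℝ (Fin d) × EuclideanSpace ℝ (Fin d))
    (a : EuclideanSpace ℝ (Fin d)) : EuclideanSpace ℝ (Fin d) :=
  z.1 + (h / 2) • (Real.exp (-(γ * h) / 2) • z.2 + Real.sqrt (1 - Real.exp (-(γ * h))) • a)

variable (z : EuclideanSpace ℝ (Fin d) × EuclideanSpace ℝ (Fin d))
  (a₁ a₂ : EuclideanSpace ℝ (Fin d))

theorem step_fst : (OUhalf γ h a₂ (verlet U h (OUhalf γ h a₁ z))).1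
    = (2 : ℝ) • stepMidpoint γ h z a₁ - z.1
      - (h ^ 2 / 2) • gradient U (stepMidpoint γ h z a₁) := by
  simp only [OUhalf, verlet, stepMidpoint]
  module

theorem smul_step_snd : (h / 2) • (OUhalf γ h a₂ (verlet U h (OUhalf γ h a₁ z))).2
    = Real.exp (-(γ * h) / 2) • ((OUhalf γ h a₂ (verlet U h (OUhalf γ h a₁ z))).1
      - stepMidpoint γ h z a₁) + (h / 2 * Real.sqrt (1 - Real.exp (-(γ * h)))) • a₂ := by
  simp only [OUhalf, verlet, stepMidpoint]
  module

end Step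

section Displacement

variable {E : Type*} [NormedAddCommGroup E] [NormedSpace ℝ E] {g : E → E} {κ L : ℝ}

theorem norm_displacement_le (hκ : 0 ≤ κ) (hκL : κ * L ≤ 1 / 200)
    (hLip : ∀ x y, ‖g x - g y‖ ≤ L * ‖x - y‖) {x x' y y' : E}
    (h : (2 : ℝ) • y - x - κ • g y = (2 : ℝ) • y' - x' - κ • g y') :
    ‖y' - y‖ ≤ 200 / 399 * ‖x' - x‖ ∧ ‖(y' - y) - (x' - x)‖ ≤ 200 / 399 * ‖x' - x‖ := by
  have hg : ‖κ • (g y' - g y)‖ ≤ 1 / 200 * ‖y' - y‖ := by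
    rw [norm_smul, Real.norm_of_nonneg hκ]
    calc κ * ‖g y' - g y‖ ≤ κ * (L * ‖y' - y‖) := by gcongr; exact hLip _ _
      _ = κ * L * ‖y' - y‖ := by ring
      _ ≤ _ := by gcongr
  have h1 : (2 : ℝ) • (y' - y) = (x' - x) + κ • (g y' - g y) := by
    linear_combination (norm := module) (-1 : ℝ) • h
  have h2 : (2 : ℝ) • ((y' - y) - (x' - x)) = -(x' - x) + κ • (g y' - g y) := by
    linear_combination (norm := module) (-1 : ℝ) • h
  have n1 := norm_add_le (x' - x) (κ • (g y' - g y))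
  have n2 := norm_add_le (-(x' - x)) (κ • (g y' - g y))
  rw [← h1, norm_smul, Real.norm_of_nonneg zero_le_two] at n1
  rw [← h2, norm_smul, Real.norm_of_nonneg zero_le_two, norm_neg] at n2
  constructor <;> linarith

theorem norm_fderiv_displacement_le (hκ : 0 ≤ κ) (hκL : κ * L ≤ 1 / 200) {H H' A : E →L[ℝ] E}
    (hH' : ‖H'‖ ≤ L) {D : ℝ} (hD : ‖H' - H‖ ≤ D)
    (h : ∀ b, (2 : ℝ) • A b = κ • (H' (A b) + (H' - H) b)) :
    ‖A‖ ≤ 200 / 399 * (κ * D) := by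
  have hD0 : 0 ≤ D := (norm_nonneg _).trans hD
  refine ContinuousLinearMap.opNorm_le_bound _ (by positivity) fun b => ?_
  have h1 : 2 * ‖A b‖ ≤ κ * (L * ‖A b‖ + D * ‖b‖) := by
    rw [← Real.norm_of_nonneg (zero_le_two (α := ℝ)), ← norm_smul, h b, norm_smul,
      Real.norm_of_nonneg hκ]
    gcongr
    refine (norm_add_le _ _).trans (add_le_add ?_ ?_)
    · exact (H'.le_opNorm _).trans (by gcongr)
    · exact ((H' - H).le_opNorm _).trans (by gcongr)
  have h2 : κ * L * ‖A b‖ ≤ 1 / 200 * ‖A b‖ := by gcongr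
  linarith

end Displacement

theorem tv_constant_le {d : ℕ} {M γ h s X V k : ℝ} (hγ : 0 < γ) (hh : 0 < h)
    (hγh : γ * h ≤ 1) (hs : 0 < s) (hs2 : γ * h / 2 ≤ s ^ 2) (hX : 0 ≤ X) (hV : 0 ≤ V)
    (hM : 0 ≤ M) (hk : k = 400 / 399) :
    2 * (((k * X + h * V) / (h * s)) ^ 2 + (k * X / (h * s)) ^ 2)
        + 20 * d * (13 / 100 * (h ^ 2 * M * X)) ^ 2 ≤
      ((7 / 2) * ((γ * h) ^ (-(3 : ℝ) / 2) + Real.sqrt d * (M * h ^ 3 / (γ * h))) *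
        Real.sqrt (γ ^ 2 * X ^ 2 + V ^ 2)) ^ 2 := by
  have ht : 0 < γ * h := by positivity
  set T := (γ * h) ^ (-(3 : ℝ) / 2)
  have hT : 0 < T := by positivity
  have hT2 : T ^ 2 = 1 / (γ * h) ^ 3 := by
    rw [← Real.rpow_natCast, ← Real.rpow_mul ht.le, one_div, ← Real.rpow_natCast,
      ← Real.rpow_neg ht.le]
    norm_num
  set c := M * h ^ 3 / (γ * h)
  have hc : c = M * h ^ 2 / γ := by simp only [c]; field_simp
  have hc0 : 0 ≤ c := by simp only [c]; positivity
  have hN : Real.sqrt (γ ^ 2 * X ^ 2 + V ^ 2) ^ 2 = γ ^ 2 * X ^ 2 + V ^ 2 :=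
    Real.sq_sqrt (by positivity)
  have h1 : 49 / 4 * (T ^ 2 + d * c ^ 2) * (γ ^ 2 * X ^ 2 + V ^ 2) ≤
      ((7 / 2) * (T + Real.sqrt d * c) * Real.sqrt (γ ^ 2 * X ^ 2 + V ^ 2)) ^ 2 := by
    rw [mul_pow, hN]
    gcongr
    have hd : Real.sqrt d ^ 2 = d := Real.sq_sqrt (Nat.cast_nonneg d)
    have h2 : 0 ≤ T * (Real.sqrt d * c) := by positivity
    have e : (7 / 2 * (T + Real.sqrt d * c)) ^ 2
        = 49 / 4 * (T ^ 2 + 2 * (T * (Real.sqrt d * c)) + Real.sqrt d ^ 2 * c ^ 2) := by ring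
    rw [e, hd]
    linarith
  refine le_trans ?_ h1
  have h2 : 2 * (((k * X + h * V) / (h * s)) ^ 2 + (k * X / (h * s)) ^ 2)
      ≤ 49 / 4 * T ^ 2 * (γ ^ 2 * X ^ 2 + V ^ 2) := by
    have e1 : 2 * (((k * X + h * V) / (h * s)) ^ 2 + (k * X / (h * s)) ^ 2)
        = 2 * ((k * X + h * V) ^ 2 + (k * X) ^ 2) / (h ^ 2 * s ^ 2) := by field_simp
    have e2 : 2 * ((k * X + h * V) ^ 2 + (k * X) ^ 2) / (h ^ 2 * s ^ 2)
        ≤ 2 * ((k * X + h * V) ^ 2 + (k * X) ^ 2) / (h ^ 2 * (γ * h / 2)) := by gcongr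
    have e3 : 2 * ((k * X + h * V) ^ 2 + (k * X) ^ 2) / (h ^ 2 * (γ * h / 2))
        = 4 * ((k * (γ * X) + γ * h * V) ^ 2 + (k * (γ * X)) ^ 2) / (γ * h) ^ 3 := by
      field_simp; ring
    rw [e1]
    refine e2.trans ?_
    rw [e3, hT2, mul_one_div, div_mul_eq_mul_div]
    refine div_le_div_of_nonneg_right ?_ (by positivity)
    have e4 : (k * (γ * X) + γ * h * V) ^ 2 ≤ (k * (γ * X) + V) ^ 2 := by
      have : γ * h * V ≤ V := mul_le_of_le_one_left hV hγh
      have hk0 : 0 ≤ k := by rw [hk]; norm_num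
      gcongr
    rw [← mul_pow γ X]
    generalize γ * X = Y at *
    subst hk
    nlinarith [sq_nonneg (Y - V), sq_nonneg Y, sq_nonneg V]
  have h3 : 20 * d * (13 / 100 * (h ^ 2 * M * X)) ^ 2
      ≤ 49 / 4 * (d * c ^ 2) * (γ ^ 2 * X ^ 2 + V ^ 2) := by
    have e1 : c ^ 2 * (γ ^ 2 * X ^ 2) = (h ^ 2 * M * X) ^ 2 := by rw [hc]; field_simp
    have e2 : 0 ≤ d * c ^ 2 * V ^ 2 := by positivity
    have e3 : 0 ≤ d * (h ^ 2 * M * X) ^ 2 := by positivity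
    have e4 : 49 / 4 * (d * c ^ 2) * (γ ^ 2 * X ^ 2 + V ^ 2)
      = 49 / 4 * (d * (c ^ 2 * (γ ^ 2 * X ^ 2))) + 49 / 4 * (d * c ^ 2 * V ^ 2) := by ring
    rw [e4, e1]
    linarith
  linarith

/-- Lemma `lem:overlap_pukLa`: the one-shot coupling TV bound for UKLA,
`‖Law(ξ₁,ξ₂) − Law(Φ(ξ₁,ξ₂))‖_TV ≤ (7/2)((γh)^{−3/2} + d^{1/2} L_H h³/(γh)) ‖z − z̃‖`. -/
theorem oneshot_coupling_tv_bound (d : ℕ) (U : EuclideanSpace ℝ (Fin d) → ℝ)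
    (L L_H γ h : ℝ)
    (hU : ContDiff ℝ 3 U) (hL : 0 < L) (hLH : 0 ≤ L_H) (hγ : 0 < γ) (hh : 0 < h)
    (hmin : ∀ x, U 0 ≤ U x) (hU0 : U 0 = 0)
    (hLip : ∀ x y, ‖gradient U x - gradient U y‖ ≤ L * ‖x - y‖)
    (hHess : ∀ x a b c : EuclideanSpace ℝ (Fin d),
      |iteratedFDeriv ℝ 3 U x ![a, b, c]| ≤ L_H * ‖a‖ * ‖b‖ * ‖c‖)
    (hfric : Real.sqrt L * γ⁻¹ ≤ 1 / 10) (hγh : γ * h ≤ 1)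
    (z z' : EuclideanSpace ℝ (Fin d) × EuclideanSpace ℝ (Fin d))
    (Φ : EuclideanSpace ℝ (Fin d) × EuclideanSpace ℝ (Fin d) →
      EuclideanSpace ℝ (Fin d) × EuclideanSpace ℝ (Fin d))
    (hΦbij : Function.Bijective Φ) (hΦdiff : Differentiable ℝ Φ)
    (hΦ : ∀ a₁ a₂ : EuclideanSpace ℝ (Fin d),
      OUhalf γ h a₂ (verlet U h (OUhalf γ h a₁ z))
        = OUhalf γ h (Φ (a₁, a₂)).2 (verlet U h (OUhalf γ h (Φ (a₁, a₂)).1 z'))) :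
    tvDist ((stdGaussian d).prod (stdGaussian d))
        (((stdGaussian d).prod (stdGaussian d)).map Φ) ≤
      ENNReal.ofReal ((7 / 2) * ((γ * h) ^ (-(3 : ℝ) / 2)
          + Real.sqrt d * (L_H * h ^ 3 / (γ * h))) *
        Real.sqrt (γ ^ 2 * ‖z.1 - z'.1‖ ^ 2 + ‖z.2 - z'.2‖ ^ 2)) := by
  set η := Real.exp (-(γ * h) / 2)
  set s := Real.sqrt (1 - Real.exp (-(γ * h)))
  have ht : 0 < γ * h := mul_pos hγ hh
  have hη : η ≤ 1 := Real.exp_le_one_iff.2 (by linarith)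
  have hη0 : 0 ≤ η := (Real.exp_pos _).le
  have hexp : Real.exp (-(γ * h)) ≤ 1 - γ * h / 2 := by
    have h1 := Real.add_one_le_exp (γ * h)
    rw [Real.exp_neg, inv_le_comm₀ (Real.exp_pos _) (by linarith)]
    refine le_trans ?_ h1
    rw [inv_le_iff_one_le_mul₀ (by linarith)]
    nlinarith
  have hs2 : γ * h / 2 ≤ s ^ 2 := by
    rw [Real.sq_sqrt (by linarith)]; linarith
  have hs : 0 < s := Real.sqrt_pos.2 (by linarith)
  have hκL : h ^ 2 / 2 * L ≤ 1 / 200 := by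
    have h1 : Real.sqrt L ≤ 1 / 10 * γ := by rwa [← div_eq_mul_inv, div_le_iff₀ hγ] at hfric
    have h2 : L ≤ (1 / 10 * γ) ^ 2 := by
      rw [← Real.sq_sqrt hL.le]; gcongr
    have h3 : h ^ 2 * L ≤ h ^ 2 * (1 / 10 * γ) ^ 2 := by gcongr
    have h4 : (γ * h) ^ 2 ≤ 1 := pow_le_one₀ ht.le hγh
    nlinarith
  have hκ : 0 ≤ h ^ 2 / 2 := by positivity
  set σ := h / 2 * s
  have hσ : 0 < σ := by positivity
  have hy (z : EuclideanSpace ℝ (Fin d) × EuclideanSpace ℝ (Fin d)) (a) :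
      stepMidpoint γ h z a = σ • a + (z.1 + (h / 2 * η) • z.2) := by
    simp only [stepMidpoint, σ, η, s]; module
  have hpos (a₁ a₂) : (2 : ℝ) • stepMidpoint γ h z a₁ - z.1
      - (h ^ 2 / 2) • gradient U (stepMidpoint γ h z a₁)
      = (2 : ℝ) • stepMidpoint γ h z' (Φ (a₁, a₂)).1 - z'.1
        - (h ^ 2 / 2) • gradient U (stepMidpoint γ h z' (Φ (a₁, a₂)).1) := by
    rw [← step_fst U γ h z a₁ a₂, hΦ a₁ a₂, step_fst]
  have hvel (a₁ a₂) : σ • ((Φ (a₁, a₂)).2 - a₂)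
      = η • (stepMidpoint γ h z' (Φ (a₁, a₂)).1 - stepMidpoint γ h z a₁) := by
    have h1 := smul_step_snd U γ h z a₁ a₂
    rw [hΦ a₁ a₂, smul_step_snd] at h1
    linear_combination (norm := module) h1
  have hfst (a₁ a₂) : (Φ (a₁, a₂)).1 = (Φ (a₁, 0)).1 := by
    have h1 := (norm_displacement_le hκ hκL hLip ((hpos a₁ 0).symm.trans (hpos a₁ a₂))).1
    rw [sub_self, norm_zero, mul_zero, norm_le_zero_iff, hy, hy, add_sub_add_right_eq_sub,
      ← smul_sub, smul_eq_zero_iff_right hσ.ne', sub_eq_zero] at h1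
    exact h1
  set w : EuclideanSpace ℝ (Fin d) → EuclideanSpace ℝ (Fin d) := fun a => (Φ (a, 0)).1 - a
  set u : EuclideanSpace ℝ (Fin d) → EuclideanSpace ℝ (Fin d) := fun a => (Φ (a, 0)).2
  have hwd : Differentiable ℝ w := by fun_prop
  have hum : Measurable u := by
    have : Differentiable ℝ u := by fun_prop
    exact this.continuous.measurable
  have hΦeq : Φ = fun x => (x.1 + w x.1, x.2 + u x.1) := by
    funext ⟨a, b⟩
    refine Prod.ext (by simp [w, hfst a b]) ?_
    have h1 := hvel a b
    rw [hfst a b, ← hvel a 0] at h1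
    have h2 := smul_right_injective _ hσ.ne' h1
    simp only [sub_zero] at h2
    exact (eq_add_of_sub_eq' h2)
  have hbij : Function.Bijective fun a => a + w a := by
    rw [hΦeq] at hΦbij
    constructor
    · intro a a' haa
      have h1 := @hΦbij.1 (a, 0) (a', u a - u a') (by simpa using haa)
      exact congrArg Prod.fst h1
    · intro b
      obtain ⟨x, hx⟩ := hΦbij.2 (b, 0)
      exact ⟨x.1, congrArg Prod.fst hx⟩
  have hdisp (a) := norm_displacement_le hκ hκL hLip (hpos a 0)
  obtain ⟨k, hk⟩ : ∃ k : ℝ, k = 400 / 399 := ⟨_, rfl⟩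
  have hhs : 0 < h * s := by positivity
  have hCw (a) : ‖w a‖ ≤ (k * ‖z.1 - z'.1‖ + h * ‖z.2 - z'.2‖) / (h * s) := by
    have h1 : σ • w a = (stepMidpoint γ h z' (Φ (a, 0)).1 - stepMidpoint γ h z a - (z'.1 - z.1))
        - (h / 2 * η) • (z'.2 - z.2) := by
      rw [hy, hy]; simp only [w]; module
    have h2 := congrArg norm h1
    rw [norm_smul, Real.norm_of_nonneg hσ.le] at h2
    have h3 := norm_sub_le (stepMidpoint γ h z' (Φ (a, 0)).1 - stepMidpoint γ h z a - (z'.1 - z.1))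
      ((h / 2 * η) • (z'.2 - z.2))
    rw [norm_smul, Real.norm_of_nonneg (by positivity)] at h3
    have h4 : h / 2 * η * ‖z'.2 - z.2‖ ≤ h / 2 * 1 * ‖z'.2 - z.2‖ := by gcongr
    have h5 := (hdisp a).2
    rw [le_div_iff₀ hhs, hk, norm_sub_rev z.1, norm_sub_rev z.2]
    simp only [σ] at h2
    linarith
  have hCu (a) : ‖u a‖ ≤ k * ‖z.1 - z'.1‖ / (h * s) := by
    have h1 := congrArg norm (hvel a 0)
    rw [sub_zero, norm_smul, norm_smul, Real.norm_of_nonneg hσ.le, Real.norm_of_nonneg hη0] at h1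
    have h2 := (hdisp a).1
    have h3 : η * ‖stepMidpoint γ h z' (Φ (a, 0)).1 - stepMidpoint γ h z a‖
        ≤ 1 * ‖stepMidpoint γ h z' (Φ (a, 0)).1 - stepMidpoint γ h z a‖ := by gcongr
    rw [le_div_iff₀ hhs, hk, norm_sub_rev z.1]
    simp only [σ] at h1
    simp only [u]
    linarith
  have hA (a b) : (2 : ℝ) • fderiv ℝ w a b = (h ^ 2 / 2) •
      (fderiv ℝ (gradient U) (stepMidpoint γ h z' (Φ (a, 0)).1) (fderiv ℝ w a b)
        + (fderiv ℝ (gradient U) (stepMidpoint γ h z' (Φ (a, 0)).1)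
          - fderiv ℝ (gradient U) (stepMidpoint γ h z a)) b) := by
    have hg (x) := (hasFDerivAt_gradient hU x).differentiableAt.hasFDerivAt
    have d1 : HasFDerivAt (fun a => stepMidpoint γ h z a)
        (σ • ContinuousLinearMap.id ℝ (EuclideanSpace ℝ (Fin d))) a := by
      simp only [hy]
      exact ((hasFDerivAt_id a).const_smul σ).add_const _
    have d2 : HasFDerivAt (fun a => stepMidpoint γ h z' (Φ (a, 0)).1)
        (σ • (ContinuousLinearMap.id ℝ (EuclideanSpace ℝ (Fin d)) + fderiv ℝ w a)) a := by
      have h1 (a) : stepMidpoint γ h z' (Φ (a, 0)).1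
          = σ • (a + w a) + (z'.1 + (h / 2 * η) • z'.2) := by rw [hy]; simp [w]
      simp only [h1]
      exact (((hasFDerivAt_id a).add (hwd a).hasFDerivAt).const_smul σ).add_const _
    have d3 : HasFDerivAt (fun a => (2 : ℝ) • stepMidpoint γ h z a - z.1
        - (h ^ 2 / 2) • gradient U (stepMidpoint γ h z a)) _ a :=
      ((d1.const_smul (2 : ℝ)).sub_const z.1).sub (((hg _).comp a d1).const_smul (h ^ 2 / 2))
    have d4 : HasFDerivAt (fun a => (2 : ℝ) • stepMidpoint γ h z' (Φ (a, 0)).1 - z'.1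
        - (h ^ 2 / 2) • gradient U (stepMidpoint γ h z' (Φ (a, 0)).1)) _ a :=
      ((d2.const_smul (2 : ℝ)).sub_const z'.1).sub (((hg _).comp a d2).const_smul (h ^ 2 / 2))
    simp only [← hpos] at d4
    have h1 := congrArg (fun l => l b) (d3.unique d4)
    simp at h1
    refine smul_right_injective _ hσ.ne' ?_
    simp
    linear_combination (norm := module) (-1 : ℝ) • h1
  have hLip' := norm_fderiv_gradient_le hL.le hLip
  have hε (a) : ‖fderiv ℝ w a‖ ≤ 13 / 100 * (h ^ 2 * L_H * ‖z.1 - z'.1‖) := by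
    have h1 := norm_fderiv_displacement_le hκ hκL (hLip' _)
      (norm_fderiv_gradient_sub_le hU hLH hHess _ _) (hA a)
    have h2 := (hdisp a).1
    rw [norm_sub_rev z'.1] at h2
    refine h1.trans ?_
    calc _ ≤ 200 / 399 * (h ^ 2 / 2 * (L_H * (200 / 399 * ‖z.1 - z'.1‖))) := by gcongr
      _ = 20000 / 399 ^ 2 * (h ^ 2 * L_H * ‖z.1 - z'.1‖) := by ring
      _ ≤ _ := mul_le_mul_of_nonneg_right (by norm_num) (by positivity)
  have hε' (a) : ‖fderiv ℝ w a‖ ≤ 1 / 100 := by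
    have h2 := hLip' (stepMidpoint γ h z' (Φ (a, 0)).1)
    have h3 := hLip' (stepMidpoint γ h z a)
    have h1 := norm_fderiv_displacement_le hκ hκL h2 (D := 2 * L)
      ((norm_sub_le _ _).trans (by linarith)) (hA a)
    linarith
  have hmain := tvDist_prod_stdGaussian_map_le hwd hbij hum hCw hCu hε hε' (R := (7 / 2) *
      ((γ * h) ^ (-(3 : ℝ) / 2) + Real.sqrt d * (L_H * h ^ 3 / (γ * h))) *
        Real.sqrt (γ ^ 2 * ‖z.1 - z'.1‖ ^ 2 + ‖z.2 - z'.2‖ ^ 2)) (by positivity)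
    (tv_constant_le hγ hh hγh hs hs2 (norm_nonneg _) (norm_nonneg _) hLH hk)
  rw [← hΦeq] at hmain
  exact hmain
end

section
/- Suppose U has a global minimum at 0 with U(0) = 0 and L-Lipschitz gradient, U ∈ C³ with |∇³U(x)⋮(a⊗b⊗c)| ≤ L_H|a||b||c| for all x,a,b,c ∈ ℝ^d, and L^{1/2}γ⁻¹ ≤ 1/10 and γh ≤ 1. Then for all z = (x,v), z̃ = (x̃,ṽ) ∈ ℝ^{2d} and all a₁, a₂, ã₁, ã₂ ∈ ℝ^d satisfying the one-shot relation O_{h/2}(a₂)∘θ_h∘O_{h/2}(a₁)(z) = O_{h/2}(ã₂)∘θ_h∘O_{h/2}(ã₁)(z̃), it holds that |a₁ − ã₁|² + |a₂ − ã₂|² ≤ (44/(γ³h³))·(γ²|x − x̃|² + |v − ṽ|²). -/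
open Real MeasureTheory

/-- The elementary bound `t / 2 ≤ 1 − e^{−t}` on `[0, 1]`. -/
theorem half_le_one_sub_exp_neg {t : ℝ} (h0 : 0 ≤ t) (h1 : t ≤ 1) :
    t / 2 ≤ 1 - Real.exp (-t) := by
  have h2 : t + 1 ≤ Real.exp t := Real.add_one_le_exp t
  have h3 : Real.exp (-t) * Real.exp t = 1 := by rw [← Real.exp_add]; simp
  have h4 := Real.exp_pos (-t)
  nlinarith [mul_le_mul_of_nonneg_left h2 h4.le]

/-- If the one-shot relation holds for two Verlet steps, the differences `X`, `V`, `A₁`, `A₂` of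
positions, velocities and noises and the difference `G` of the midpoint forces satisfy these two
linear relations, from which the noise differences are bounded by `X` and `V`. -/
theorem norm_sq_add_norm_sq_le_of_oneshot {E : Type*} [NormedAddCommGroup E] [NormedSpace ℝ E]
    {X V A₁ A₂ G : E} {η s h L : ℝ} (hh : 0 < h) (hη0 : 0 ≤ η) (hη1 : η ≤ 1) (hs : 0 ≤ s)
    (hL : L * h ^ 2 ≤ 1 / 100)
    (hG : ‖G‖ ≤ L * ‖X + (h / 2) • (η • V + s • A₁)‖)
    (hpos : X + (h / 2) • (η • V + s • A₁) + (h / 2) • (η • V + s • A₁ - h • G) = 0)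
    (hvel : η • (η • V + s • A₁ - h • G) + s • A₂ = 0) :
    h ^ 2 * s ^ 2 * (‖A₁‖ ^ 2 + ‖A₂‖ ^ 2) ≤ 7 * (‖X‖ ^ 2 + h ^ 2 * ‖V‖ ^ 2) := by
  have e1 : (h * s) • A₁ = -X + (h ^ 2 / 2) • G - (h * η) • V := by
    linear_combination (norm := module) hpos
  have e2 : (h * s) • A₂ = η • (X + (h ^ 2 / 2) • G) := by
    linear_combination (norm := module) h • hvel - η • hpos
  have e3 : X + (h / 2) • (η • V + s • A₁) = (1 / 2 : ℝ) • X + (h ^ 2 / 4) • G := by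
    linear_combination (norm := module) (1 / 2 : ℝ) • hpos
  have hM : ‖X + (h / 2) • (η • V + s • A₁)‖ ≤ 1 / 2 * ‖X‖ + h ^ 2 / 4 * ‖G‖ := by
    rw [e3]
    refine (norm_add_le _ _).trans_eq ?_
    rw [norm_smul, norm_smul, Real.norm_of_nonneg (by positivity),
      Real.norm_of_nonneg (by positivity)]
  have hGX : h ^ 2 * ‖G‖ ≤ ‖X‖ := by
    have h1 := mul_le_mul_of_nonneg_left hG (sq_nonneg h)
    have h2 := mul_le_mul_of_nonneg_right hL (norm_nonneg (X + (h / 2) • (η • V + s • A₁)))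
    linarith [norm_nonneg X, mul_nonneg (sq_nonneg h) (norm_nonneg G)]
  have hA₁ : h * s * ‖A₁‖ ≤ 3 / 2 * ‖X‖ + h * ‖V‖ := by
    have h1 : h * s * ‖A₁‖ = ‖(h * s) • A₁‖ := by
      rw [norm_smul, Real.norm_of_nonneg (by positivity)]
    have h2 : ‖-X + (h ^ 2 / 2) • G‖ ≤ ‖X‖ + h ^ 2 / 2 * ‖G‖ := by
      refine (norm_add_le _ _).trans_eq ?_
      rw [norm_neg, norm_smul, Real.norm_of_nonneg (by positivity)]
    have h3 : ‖(h * η) • V‖ ≤ h * ‖V‖ := by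
      rw [norm_smul, Real.norm_of_nonneg (by positivity)]
      gcongr
      exact mul_le_of_le_one_right hh.le hη1
    rw [h1, e1]
    linarith [norm_sub_le (-X + (h ^ 2 / 2) • G) ((h * η) • V)]
  have hA₂ : h * s * ‖A₂‖ ≤ 3 / 2 * ‖X‖ := by
    have h1 : h * s * ‖A₂‖ = ‖(h * s) • A₂‖ := by
      rw [norm_smul, Real.norm_of_nonneg (by positivity)]
    have h2 : ‖X + (h ^ 2 / 2) • G‖ ≤ ‖X‖ + h ^ 2 / 2 * ‖G‖ := by
      refine (norm_add_le _ _).trans_eq ?_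
      rw [norm_smul, Real.norm_of_nonneg (by positivity)]
    rw [h1, e2, norm_smul, Real.norm_of_nonneg hη0]
    linarith [mul_le_of_le_one_left (norm_nonneg (X + (h ^ 2 / 2) • G)) hη1]
  have hsq₁ := pow_le_pow_left₀ (by positivity) hA₁ 2
  have hsq₂ := pow_le_pow_left₀ (by positivity) hA₂ 2
  nlinarith [sq_nonneg (3 / 2 * ‖X‖ - h * ‖V‖), sq_nonneg ‖X‖, sq_nonneg (h * ‖V‖)]

/-- Lemma `lem:oneshot:a`: under the one-shot relation,
`|a₁ − ã₁|² + |a₂ − ã₂|² ≤ (44/(γ³h³)) (γ²|x − x̃|² + |v − ṽ|²)`. -/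
theorem oneshot_noise_bound (d : ℕ) (U : EuclideanSpace ℝ (Fin d) → ℝ) (L L_H γ h : ℝ)
    (hU : ContDiff ℝ 3 U) (hL : 0 < L) (hLH : 0 ≤ L_H) (hγ : 0 < γ) (hh : 0 < h)
    (hmin : ∀ x, U 0 ≤ U x) (hU0 : U 0 = 0)
    (hLip : ∀ x y, ‖gradient U x - gradient U y‖ ≤ L * ‖x - y‖)
    (hHess : ∀ x a b c : EuclideanSpace ℝ (Fin d),
      |iteratedFDeriv ℝ 3 U x ![a, b, c]| ≤ L_H * ‖a‖ * ‖b‖ * ‖c‖)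
    (hfric : Real.sqrt L * γ⁻¹ ≤ 1 / 10) (hγh : γ * h ≤ 1)
    (z z' : EuclideanSpace ℝ (Fin d) × EuclideanSpace ℝ (Fin d))
    (a₁ a₂ a₁' a₂' : EuclideanSpace ℝ (Fin d))
    (honeshot : OUhalf γ h a₂ (verlet U h (OUhalf γ h a₁ z))
      = OUhalf γ h a₂' (verlet U h (OUhalf γ h a₁' z'))) :
    ‖a₁ - a₁'‖ ^ 2 + ‖a₂ - a₂'‖ ^ 2 ≤
      44 / (γ ^ 3 * h ^ 3) * (γ ^ 2 * ‖z.1 - z'.1‖ ^ 2 + ‖z.2 - z'.2‖ ^ 2) := by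
  have hLγ : L ≤ γ ^ 2 / 100 := by
    have h1 : Real.sqrt L ≤ γ / 10 := by
      rw [← div_eq_mul_inv, div_le_iff₀ hγ] at hfric
      linarith
    have h2 := pow_le_pow_left₀ (Real.sqrt_nonneg L) h1 2
    rw [Real.sq_sqrt hL.le] at h2
    linarith
  have ht : 0 < γ * h := mul_pos hγ hh
  have ht2 : γ ^ 2 * h ^ 2 ≤ 1 := by
    rw [← mul_pow]
    exact pow_le_one₀ ht.le hγh
  have hLh : L * h ^ 2 ≤ 1 / 100 := by
    linarith [mul_le_mul_of_nonneg_right hLγ (sq_nonneg h)]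
  have hs := half_le_one_sub_exp_neg ht.le hγh
  have hη0 : 0 ≤ Real.exp (-(γ * h) / 2) := (Real.exp_pos _).le
  have hη1 : Real.exp (-(γ * h) / 2) ≤ 1 := Real.exp_le_one_iff.2 (by linarith)
  have hs2 : Real.sqrt (1 - Real.exp (-(γ * h))) ^ 2 = 1 - Real.exp (-(γ * h)) :=
    Real.sq_sqrt (by linarith)
  have hs0 := Real.sqrt_nonneg (1 - Real.exp (-(γ * h)))
  simp only [OUhalf, verlet, Prod.mk.injEq] at honeshot
  obtain ⟨hx, hv⟩ := honeshot
  rw [← hs2] at hs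
  generalize Real.sqrt (1 - Real.exp (-(γ * h))) = s at *
  generalize Real.exp (-(γ * h) / 2) = η at *
  have hG := hLip (z.1 + (h / 2) • (η • z.2 + s • a₁)) (z'.1 + (h / 2) • (η • z'.2 + s • a₁'))
  generalize gradient U (z.1 + (h / 2) • (η • z.2 + s • a₁)) = g at *
  generalize gradient U (z'.1 + (h / 2) • (η • z'.2 + s • a₁')) = g' at *
  have key := norm_sq_add_norm_sq_le_of_oneshot (X := z.1 - z'.1) (V := z.2 - z'.2)
    (A₁ := a₁ - a₁') (A₂ := a₂ - a₂') (G := g - g') hh hη0 hη1 hs0 hLh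
    (hG.trans_eq (by congr 2; module))
    (by linear_combination (norm := module) hx) (by linear_combination (norm := module) hv)
  have hS : 0 ≤ ‖a₁ - a₁'‖ ^ 2 + ‖a₂ - a₂'‖ ^ 2 := by positivity
  generalize ‖a₁ - a₁'‖ ^ 2 + ‖a₂ - a₂'‖ ^ 2 = S at *
  have h1 : γ ^ 2 * (h ^ 2 * (γ * h / 2) * S) ≤
      γ ^ 2 * (7 * (‖z.1 - z'.1‖ ^ 2 + h ^ 2 * ‖z.2 - z'.2‖ ^ 2)) := by
    refine mul_le_mul_of_nonneg_left (le_trans ?_ key) (sq_nonneg γ)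
    gcongr
  have h2 := mul_le_mul_of_nonneg_right ht2 (sq_nonneg ‖z.2 - z'.2‖)
  rw [div_mul_eq_mul_div, le_div_iff₀ (by positivity)]
  nlinarith [sq_nonneg (γ * ‖z.1 - z'.1‖), sq_nonneg ‖z.2 - z'.2‖]
end

section
/- Suppose U has a global minimum at 0 with U(0) = 0 and L-Lipschitz gradient, U ∈ C³ with |∇³U(x)⋮(a⊗b⊗c)| ≤ L_H|a||b||c| for all x,a,b,c ∈ ℝ^d, and L^{1/2}γ⁻¹ ≤ 1/10 and γh ≤ 1. Let z = (x,v), z̃ = (x̃,ṽ) ∈ ℝ^{2d} and a₁, a₂, ã₁, ã₂ ∈ ℝ^d satisfy the one-shot relation O_{h/2}(a₂)∘θ_h∘O_{h/2}(a₁)(z) = O_{h/2}(ã₂)∘θ_h∘O_{h/2}(ã₁)(z̃), and set x* = x + (h/2)(e^{−γh/2}v + (1−e^{−γh})^{1/2}a₁) and x̃* = x̃ + (h/2)(e^{−γh/2}ṽ + (1−e^{−γh})^{1/2}ã₁). Then any d×d matrix M satisfying M − I_d = −(h²/4)·(∇²U(x*) − ∇²U(x̃*)·M) obeys the operator-norm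 bound ‖M − I_d‖ ≤ min( 1/2, (8/7)^{1/2}·(L_H h³/(γh))·(γ²|x − x̃|² + |v − ṽ|²)^{1/2} ). -/
open Real MeasureTheory

/-- The Hessian `∇²U(x)` of `U`, as a continuous linear map. -/
noncomputable def hess {d : ℕ} (U : EuclideanSpace ℝ (Fin d) → ℝ)
    (x : EuclideanSpace ℝ (Fin d)) :
    EuclideanSpace ℝ (Fin d) →L[ℝ] EuclideanSpace ℝ (Fin d) :=
  fderiv ℝ (gradient U) x

section Hessian

variable {d : ℕ} {U : EuclideanSpace ℝ (Fin d) → ℝ}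

theorem contDiff_gradient {n : WithTop ℕ∞} (hU : ContDiff ℝ (n + 1) U) :
    ContDiff ℝ n (gradient U) := by
  have h : ContDiff ℝ n (fderiv ℝ U) := hU.fderiv_right le_rfl
  exact ((InnerProductSpace.toDual ℝ (EuclideanSpace ℝ (Fin d))).symm :
    StrongDual ℝ (EuclideanSpace ℝ (Fin d)) ≃ₗᵢ[ℝ] EuclideanSpace ℝ (Fin d)).contDiff.comp h

theorem inner_hess_apply (hU : ContDiff ℝ 2 U) (x b c : EuclideanSpace ℝ (Fin d)) :
    inner ℝ (hess U x b) c = iteratedFDeriv ℝ 2 U x ![b, c] := by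
  have hg : DifferentiableAt ℝ (gradient U) x :=
    (contDiff_gradient (n := 1) (by simpa [one_add_one_eq_two] using hU)).differentiable
      one_ne_zero x
  have hf : DifferentiableAt ℝ (fderiv ℝ U) x :=
    (hU.fderiv_right (m := 1) (by norm_num [one_add_one_eq_two])).differentiable one_ne_zero x
  have hfun : (fun y => inner ℝ (gradient U y) c) = fun y => fderiv ℝ U y c := by
    funext y
    simp [gradient]
  have h₁ := (hg.hasFDerivAt.inner ℝ (hasFDerivAt_const c x))
  have h₂ := hf.hasFDerivAt.clm_apply (hasFDerivAt_const c x)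
  rw [hfun] at h₁
  have h := congrArg (fun T => T b) (h₁.unique h₂)
  rw [iteratedFDeriv_two_apply]
  simpa [hess] using h

theorem norm_hess_le {L : ℝ} (hL : 0 ≤ L)
    (hLip : ∀ x y, ‖gradient U x - gradient U y‖ ≤ L * ‖x - y‖)
    (x : EuclideanSpace ℝ (Fin d)) : ‖hess U x‖ ≤ L :=
  norm_fderiv_le_of_lip' ℝ hL (Filter.Eventually.of_forall fun y => hLip y x)

theorem norm_hess_sub_le {K : ℝ} (hU : ContDiff ℝ 3 U) (hK : 0 ≤ K)
    (hHess : ∀ x a b c : EuclideanSpace ℝ (Fin d),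
      |iteratedFDeriv ℝ 3 U x ![a, b, c]| ≤ K * ‖a‖ * ‖b‖ * ‖c‖)
    (x y : EuclideanSpace ℝ (Fin d)) :
    ‖hess U x - hess U y‖ ≤ K * ‖x - y‖ := by
  have hU₂ : ContDiff ℝ 2 U := hU.of_le (by norm_num)
  have hd : Differentiable ℝ (iteratedFDeriv ℝ 2 U) :=
    hU.differentiable_iteratedFDeriv (by norm_cast)
  have key (b c : EuclideanSpace ℝ (Fin d)) :
      |inner ℝ ((hess U x - hess U y) b) c| ≤ K * ‖b‖ * ‖c‖ * ‖x - y‖ := by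
    have hderiv (w : EuclideanSpace ℝ (Fin d)) :=
      (ContinuousMultilinearMap.apply ℝ (fun _ : Fin 2 => EuclideanSpace ℝ (Fin d)) ℝ
        ![b, c]).hasFDerivAt.comp w (hd w).hasFDerivAt
    have hmv := convex_univ.norm_image_sub_le_of_norm_hasFDerivWithin_le
      (C := K * ‖b‖ * ‖c‖) (fun w _ => (hderiv w).hasFDerivWithinAt)
      (fun w _ => ContinuousLinearMap.opNorm_le_bound _ (by positivity) fun a => by
        have h := hHess w a b c
        rw [iteratedFDeriv_succ_apply_left] at h
        calc _ ≤ K * ‖a‖ * ‖b‖ * ‖c‖ := h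
          _ = _ := by ring) (Set.mem_univ y) (Set.mem_univ x)
    rw [sub_apply, inner_sub_left, inner_hess_apply hU₂, inner_hess_apply hU₂]
    exact hmv
  refine ContinuousLinearMap.opNorm_le_bound _ (by positivity) fun b => ?_
  set T := (hess U x - hess U y) b
  have h := key b T
  rw [real_inner_self_eq_norm_sq, abs_of_nonneg (sq_nonneg _)] at h
  rcases (norm_nonneg T).eq_or_lt with h0 | h0
  · rw [← h0]; positivity
  · refine le_of_mul_le_mul_right ?_ h0
    calc ‖T‖ * ‖T‖ = ‖T‖ ^ 2 := by ring
      _ ≤ _ := h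
      _ = _ := by ring

end Hessian

/-- If the one-shot relation holds, the midpoints of the two Verlet steps are close as soon as the
initial positions are. -/
theorem norm_midpoint_sub_le {d : ℕ} {U : EuclideanSpace ℝ (Fin d) → ℝ} {L γ h : ℝ}
    (hLip : ∀ x y, ‖gradient U x - gradient U y‖ ≤ L * ‖x - y‖)
    {z z' : EuclideanSpace ℝ (Fin d) × EuclideanSpace ℝ (Fin d)}
    {a₁ a₂ a₁' a₂' : EuclideanSpace ℝ (Fin d)}
    (honeshot : OUhalf γ h a₂ (verlet U h (OUhalf γ h a₁ z))
      = OUhalf γ h a₂' (verlet U h (OUhalf γ h a₁' z')))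
    {y y' : EuclideanSpace ℝ (Fin d)}
    (hy : y = z.1 + (h / 2) •
      (Real.exp (-(γ * h) / 2) • z.2 + Real.sqrt (1 - Real.exp (-(γ * h))) • a₁))
    (hy' : y' = z'.1 + (h / 2) •
      (Real.exp (-(γ * h) / 2) • z'.2 + Real.sqrt (1 - Real.exp (-(γ * h))) • a₁')) :
    ‖y - y'‖ ≤ ‖z.1 - z'.1‖ / 2 + h ^ 2 * L / 4 * ‖y - y'‖ := by
  have hpos := congrArg Prod.fst honeshot
  simp only [OUhalf, verlet] at hpos
  rw [← hy, ← hy'] at hpos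
  set w := Real.exp (-(γ * h) / 2) • z.2 + Real.sqrt (1 - Real.exp (-(γ * h))) • a₁
  set w' := Real.exp (-(γ * h) / 2) • z'.2 + Real.sqrt (1 - Real.exp (-(γ * h))) • a₁'
  have hdiff : y - y' = (1 / 2 : ℝ) • (z.1 - z'.1)
      + (h ^ 2 / 4) • (gradient U y - gradient U y') := by
    have e : (h / 2) • w = y - z.1 := by rw [hy]; abel
    have e' : (h / 2) • w' = y' - z'.1 := by rw [hy']; abel
    rw [smul_sub, smul_sub, e, e', smul_smul, smul_smul] at hpos
    linear_combination (norm := module) (1 / 2 : ℝ) • hpos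
  have hn := norm_add_le ((1 / 2 : ℝ) • (z.1 - z'.1))
    ((h ^ 2 / 4) • (gradient U y - gradient U y'))
  rw [← hdiff, norm_smul, norm_smul, Real.norm_of_nonneg (by positivity),
    Real.norm_of_nonneg (by positivity)] at hn
  have := mul_le_mul_of_nonneg_left (hLip y y') (show 0 ≤ h ^ 2 / 4 by positivity)
  linarith

/-- A solution of the fixed point equation `M - 1 = -c (A - B M)` is close to the identity when
`A` and `B` are close. -/
theorem norm_sub_one_le_of_fixedPoint {R : Type*} [NormedRing R] [NormedAlgebra ℝ R] {c : ℝ}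
    (hc : 0 ≤ c) {A B M : R} (hM : M - 1 = (-c) • (A - B * M)) :
    ‖M - 1‖ ≤ c * ‖A - B‖ + c * ‖B‖ * ‖M - 1‖ := by
  have h : M - 1 = (-c) • (A - B) + c • (B * (M - 1)) := by
    rw [mul_sub, mul_one]
    calc M - 1 = _ := hM
      _ = _ := by module
  have hn := norm_add_le ((-c) • (A - B)) (c • (B * (M - 1)))
  rw [← h, norm_smul, norm_smul, norm_neg, Real.norm_of_nonneg hc] at hn
  have := mul_le_mul_of_nonneg_left (norm_mul_le B (M - 1)) hc
  linarith

/-- key estimate in Lemma `lem:oneshot:b`: any matrix `M` solving the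
fixed point equation `M − I = −(h²/4)(∇²U(x*) − ∇²U(x̃*) M)` satisfies the operator-norm
bound `‖M − I‖ ≤ min(1/2, √(8/7)·(L_H h³/(γh))·‖z − z̃‖)`. -/
theorem oneshot_jacobian_block_bound (d : ℕ) (U : EuclideanSpace ℝ (Fin d) → ℝ)
    (L L_H γ h : ℝ)
    (hU : ContDiff ℝ 3 U) (hL : 0 < L) (hLH : 0 ≤ L_H) (hγ : 0 < γ) (hh : 0 < h)
    (hmin : ∀ x, U 0 ≤ U x) (hU0 : U 0 = 0)
    (hLip : ∀ x y, ‖gradient U x - gradient U y‖ ≤ L * ‖x - y‖)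
    (hHess : ∀ x a b c : EuclideanSpace ℝ (Fin d),
      |iteratedFDeriv ℝ 3 U x ![a, b, c]| ≤ L_H * ‖a‖ * ‖b‖ * ‖c‖)
    (hfric : Real.sqrt L * γ⁻¹ ≤ 1 / 10) (hγh : γ * h ≤ 1)
    (z z' : EuclideanSpace ℝ (Fin d) × EuclideanSpace ℝ (Fin d))
    (a₁ a₂ a₁' a₂' : EuclideanSpace ℝ (Fin d))
    (honeshot : OUhalf γ h a₂ (verlet U h (OUhalf γ h a₁ z))
      = OUhalf γ h a₂' (verlet U h (OUhalf γ h a₁' z')))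
    (xstar xstar' : EuclideanSpace ℝ (Fin d))
    (hxstar : xstar = z.1 + (h / 2) •
      (Real.exp (-(γ * h) / 2) • z.2 + Real.sqrt (1 - Real.exp (-(γ * h))) • a₁))
    (hxstar' : xstar' = z'.1 + (h / 2) •
      (Real.exp (-(γ * h) / 2) • z'.2 + Real.sqrt (1 - Real.exp (-(γ * h))) • a₁'))
    (M : EuclideanSpace ℝ (Fin d) →L[ℝ] EuclideanSpace ℝ (Fin d))
    (hM : M - 1 = (-(h ^ 2 / 4)) • (hess U xstar - hess U xstar' * M)) :
    ‖M - 1‖ ≤ min (1 / 2)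
      (Real.sqrt (8 / 7) * (L_H * h ^ 3 / (γ * h)) *
        Real.sqrt (γ ^ 2 * ‖z.1 - z'.1‖ ^ 2 + ‖z.2 - z'.2‖ ^ 2)) := by
  have hLγ : L ≤ γ ^ 2 / 100 := by
    have h₁ : Real.sqrt L ≤ γ / 10 := by
      rw [← div_eq_mul_inv, div_le_iff₀ hγ] at hfric
      linarith
    have h₂ := (Real.sqrt_le_left (by positivity)).1 h₁
    nlinarith
  have hh2L : h ^ 2 * L ≤ 1 / 100 := by
    have h₁ : (γ * h) ^ 2 ≤ 1 := pow_le_one₀ (by positivity) hγh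
    nlinarith [mul_le_mul_of_nonneg_left hLγ (sq_nonneg h)]
  have hA := norm_hess_le hL.le hLip xstar
  have hB := norm_hess_le hL.le hLip xstar'
  have hAB := norm_hess_sub_le hU hLH hHess xstar xstar'
  have hmid := norm_midpoint_sub_le hLip honeshot hxstar hxstar'
  have hfix := norm_sub_one_le_of_fixedPoint (by positivity) hM
  have hmid' : ‖xstar - xstar'‖ ≤ ‖z.1 - z'.1‖ := by
    have := mul_le_mul_of_nonneg_right hh2L (norm_nonneg (xstar - xstar'))
    linarith [norm_nonneg (xstar - xstar'), norm_nonneg (z.1 - z'.1)]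
  have hfix' : ‖M - 1‖ ≤ h ^ 2 / 2 * ‖hess U xstar - hess U xstar'‖ := by
    have h₁ : h ^ 2 / 4 * ‖hess U xstar'‖ ≤ 1 / 400 := by
      nlinarith [mul_le_mul_of_nonneg_left hB (sq_nonneg h)]
    have h₂ := mul_le_mul_of_nonneg_right h₁ (norm_nonneg (M - 1))
    linarith [norm_nonneg (M - 1)]
  refine le_min ?_ ?_
  · have h₁ : ‖hess U xstar - hess U xstar'‖ ≤ 2 * L := by
      linarith [norm_sub_le (hess U xstar) (hess U xstar')]
    nlinarith [mul_le_mul_of_nonneg_left h₁ (sq_nonneg h)]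
  · have hdist : γ * ‖z.1 - z'.1‖ ≤ Real.sqrt (γ ^ 2 * ‖z.1 - z'.1‖ ^ 2 + ‖z.2 - z'.2‖ ^ 2) :=
      Real.le_sqrt_of_sq_le (by nlinarith [sq_nonneg ‖z.2 - z'.2‖])
    have hconst : 1 ≤ Real.sqrt (8 / 7) := Real.one_le_sqrt.2 (by norm_num)
    calc ‖M - 1‖ ≤ h ^ 2 / 2 * ‖hess U xstar - hess U xstar'‖ := hfix'
      _ ≤ h ^ 2 * (L_H * ‖z.1 - z'.1‖) := by
        have h₁ := hAB.trans (mul_le_mul_of_nonneg_left hmid' hLH)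
        have h₂ := mul_le_mul_of_nonneg_left h₁ (show 0 ≤ h ^ 2 / 2 by positivity)
        have h₃ : 0 ≤ h ^ 2 * (L_H * ‖z.1 - z'.1‖) := by positivity
        linarith
      _ = 1 * (L_H * h ^ 3 / (γ * h)) * (γ * ‖z.1 - z'.1‖) := by
        field_simp
      _ ≤ _ := by gcongr
end

section
/- Suppose U has a global minimum at 0 with U(0) = 0 and L-Lipschitz gradient, and Lh² ≤ 1. Then the energy error ΔH = H∘θ_h − H satisfies |ΔH(z)| ≤ 4·L·h²·ℰ(z) for all z ∈ ℝ^{2d}. -/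
open Real MeasureTheory

/-- The Hamiltonian `H(x,v) = |v|²/2 + U(x)`. -/
noncomputable def Ham {d : ℕ} (U : EuclideanSpace ℝ (Fin d) → ℝ)
    (z : EuclideanSpace ℝ (Fin d) × EuclideanSpace ℝ (Fin d)) : ℝ :=
  ‖z.2‖ ^ 2 / 2 + U z.1

/-- The energy-like function `ℰ(x,v) = |v|² + L⁻¹|∇U(x)|²`. -/
noncomputable def calE {d : ℕ} (U : EuclideanSpace ℝ (Fin d) → ℝ) (L : ℝ)
    (z : EuclideanSpace ℝ (Fin d) × EuclideanSpace ℝ (Fin d)) : ℝ :=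
  ‖z.2‖ ^ 2 + L⁻¹ * ‖gradient U z.1‖ ^ 2

/-- First-order Taylor estimate for a function with Lipschitz gradient. -/
theorem abs_sub_sub_inner_gradient_le {E : Type*} [NormedAddCommGroup E] [InnerProductSpace ℝ E]
    [CompleteSpace E] {U : E → ℝ} {L : ℝ} (hL : 0 ≤ L) (hU : Differentiable ℝ U)
    (hLip : ∀ x y, ‖gradient U x - gradient U y‖ ≤ L * ‖x - y‖) (a b : E) :
    |U b - U a - inner ℝ (gradient U a) (b - a)| ≤ L * ‖b - a‖ ^ 2 := by
  have key := (convex_segment a b).norm_image_sub_le_of_norm_hasFDerivWithin_le'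
    (f := U) (f' := fun x => InnerProductSpace.toDual ℝ E (gradient U x))
    (φ := InnerProductSpace.toDual ℝ E (gradient U a)) (C := L * ‖b - a‖)
    (fun x _ => (hU x).hasGradientAt.hasFDerivAt.hasFDerivWithinAt)
    (fun x hx => by
      rw [← map_sub, LinearIsometryEquiv.norm_map]
      refine (hLip x a).trans (mul_le_mul_of_nonneg_left ?_ hL)
      exact norm_sub_le_of_mem_segment hx)
    (left_mem_segment ℝ a b) (right_mem_segment ℝ a b)
  rw [Real.norm_eq_abs, InnerProductSpace.toDual_apply_apply] at key
  linarith

/-- Lower-order energy error bound for the Verlet integrator: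
if `U` is continuously differentiable with global minimum `U(0) = 0` and `L`-Lipschitz
gradient, and `L h² ≤ 1`, then `|ΔH(z)| ≤ 4 L h² ℰ(z)` for all `z`. -/
theorem energy_error_low_order (d : ℕ) (U : EuclideanSpace ℝ (Fin d) → ℝ) (L h : ℝ)
    (hU : ContDiff ℝ 1 U) (hL : 0 < L) (hh : 0 < h)
    (hmin : ∀ x, U 0 ≤ U x) (hU0 : U 0 = 0)
    (hLip : ∀ x y, ‖gradient U x - gradient U y‖ ≤ L * ‖x - y‖)
    (hLh : L * h ^ 2 ≤ 1)
    (z : EuclideanSpace ℝ (Fin d) × EuclideanSpace ℝ (Fin d)) :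
    |Ham U (verlet U h z) - Ham U z| ≤ 4 * L * h ^ 2 * calE U L z := by
  obtain ⟨x, v⟩ := z
  have hdiff : Differentiable ℝ U := hU.differentiable (by norm_num)
  simp only [Ham, calE, verlet]
  set y := x + (h / 2) • v with hy
  set g := gradient U y with hg
  set w := v - h • g with hw
  have taylor_w := abs_sub_sub_inner_gradient_le hL.le hdiff hLip y (y + (h / 2) • w)
  have taylor_v := abs_sub_sub_inner_gradient_le hL.le hdiff hLip y x
  have hxy : x - y = -((h / 2) • v) := by rw [hy]; abel
  rw [add_sub_cancel_left, ← hg, inner_smul_right, norm_smul, mul_pow,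
    Real.norm_of_nonneg (by positivity)] at taylor_w
  rw [hxy, ← hg, inner_neg_right, inner_smul_right, norm_neg, norm_smul, mul_pow,
    Real.norm_of_nonneg (by positivity)] at taylor_v
  have hgw : inner ℝ g w = inner ℝ g v - h * ‖g‖ ^ 2 := by
    rw [hw, inner_sub_right, inner_smul_right, real_inner_self_eq_norm_sq]
  have hww : ‖w‖ ^ 2 = ‖v‖ ^ 2 - 2 * h * inner ℝ g v + h ^ 2 * ‖g‖ ^ 2 := by
    rw [hw, norm_sub_sq_real, inner_smul_right, norm_smul, Real.norm_of_nonneg hh.le,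
      real_inner_comm]
    ring
  -- The first-order terms cancel exactly, so only the two Taylor remainders are left.
  have energy : |‖w‖ ^ 2 / 2 + U (y + (h / 2) • w) - (‖v‖ ^ 2 / 2 + U x)| ≤
      L * h ^ 2 / 4 * (‖w‖ ^ 2 + ‖v‖ ^ 2) := by
    rw [hgw] at taylor_w
    rw [abs_le] at *
    constructor <;> linarith [taylor_w.1, taylor_w.2, taylor_v.1, taylor_v.2]
  have hgnorm : ‖g‖ ≤ ‖gradient U x‖ + L * (h / 2 * ‖v‖) := by
    have hle := hLip y x
    rw [norm_sub_rev y x, hxy, norm_neg, norm_smul, Real.norm_of_nonneg (by positivity)] at hle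
    linarith [norm_sub_norm_le g (gradient U x)]
  have hwnorm : ‖w‖ ≤ 3 / 2 * ‖v‖ + h * ‖gradient U x‖ := by
    have hle : ‖w‖ ≤ ‖v‖ + h * ‖g‖ := by
      simpa [norm_smul, abs_of_pos hh] using norm_sub_le v (h • g)
    nlinarith [mul_le_mul_of_nonneg_left hgnorm hh.le,
      mul_le_mul_of_nonneg_right hLh (norm_nonneg v)]
  have hwsq : ‖w‖ ^ 2 ≤ 9 / 2 * ‖v‖ ^ 2 + 2 * (h ^ 2 * ‖gradient U x‖ ^ 2) := by
    nlinarith [pow_le_pow_left₀ (norm_nonneg w) hwnorm 2,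
      sq_nonneg (3 / 2 * ‖v‖ - h * ‖gradient U x‖)]
  have hhsq : h ^ 2 * ‖gradient U x‖ ^ 2 ≤ L⁻¹ * ‖gradient U x‖ ^ 2 := by
    gcongr
    rwa [← one_div, le_div_iff₀' hL]
  have hgrad : 0 ≤ L⁻¹ * ‖gradient U x‖ ^ 2 := by positivity
  calc _ ≤ L * h ^ 2 / 4 * (‖w‖ ^ 2 + ‖v‖ ^ 2) := energy
    _ ≤ L * h ^ 2 / 4 * (16 * (‖v‖ ^ 2 + L⁻¹ * ‖gradient U x‖ ^ 2)) := by
      gcongr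
      linarith [sq_nonneg ‖v‖]
    _ = _ := by ring
end

section
/- Suppose U has a global minimum at 0 with U(0) = 0 and L-Lipschitz gradient, U ∈ C³ with |∇³U(x)⋮(a⊗b⊗c)| ≤ L_H|a||b||c| for all x,a,b,c ∈ ℝ^d, and Lh² ≤ 1. Then the energy error ΔH = H∘θ_h − H satisfies |ΔH(z)| ≤ 2·L_H·h³·ℰ(z)^{3/2} + L^{3/2}·h³·ℰ(z) for all z ∈ ℝ^{2d}. -/
open Real MeasureTheory

/-- Third-order Taylor expansion with Lagrange remainder on an unordered interval. -/
theorem exists_taylor_two_eq {f : ℝ → ℝ} (hf : ContDiff ℝ 3 f) {x : ℝ} (hx : (0 : ℝ) ≠ x) :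
    ∃ ξ, f x = f 0 + x * deriv f 0 + x ^ 2 / 2 * iteratedDeriv 2 f 0 +
      iteratedDeriv 3 f ξ * x ^ 3 / 6 := by
  obtain ⟨ξ, -, hξ⟩ := taylor_mean_remainder_lagrange_iteratedDeriv (n := 2) hx
    (by norm_num; exact hf.contDiffOn)
  refine ⟨ξ, ?_⟩
  have hw (k : ℕ) (hk : (k : WithTop ℕ∞) ≤ 3) :
      iteratedDerivWithin k f (Set.uIcc 0 x) 0 = iteratedDeriv k f 0 :=
    iteratedDerivWithin_eq_iteratedDeriv (uniqueDiffOn_uIcc hx) (hf.of_le hk).contDiffAt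
      Set.left_mem_uIcc
  rw [taylor_within_apply] at hξ
  simp only [Finset.sum_range_succ, Finset.range_zero, Finset.sum_empty, zero_add] at hξ
  rw [hw 0 (by norm_num), hw 1 (by norm_num), hw 2 (by norm_num)] at hξ
  simp [Nat.factorial] at hξ
  linarith

/-- Error bound for the central difference quotient with unit step. -/
theorem abs_central_difference_le {f : ℝ → ℝ} (hf : ContDiff ℝ 3 f) {M : ℝ}
    (hM : ∀ t, |iteratedDeriv 3 f t| ≤ M) :
    |f 1 - f (-1) - 2 * deriv f 0| ≤ M / 3 := by
  obtain ⟨a, ha⟩ := exists_taylor_two_eq hf (x := 1) (by norm_num)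
  obtain ⟨b, hb⟩ := exists_taylor_two_eq hf (x := -1) (by norm_num)
  have h₁ := abs_le.1 (hM a)
  have h₂ := abs_le.1 (hM b)
  rw [ha, hb, abs_le]
  constructor <;> linarith

section InnerProductSpace

variable {E : Type*} [NormedAddCommGroup E] [InnerProductSpace ℝ E]

theorem iteratedDeriv_comp_line {U : E → ℝ} {n : ℕ} (hU : ContDiff ℝ n U) (c u : E) (t : ℝ) :
    iteratedDeriv n (fun s : ℝ => U (c + s • u)) t =
      iteratedFDeriv ℝ n U (c + t • u) fun _ => u := by
  have hV : ContDiff ℝ n fun y => U (c + y) := hU.comp (contDiff_const.add contDiff_id)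
  have h := (ContinuousLinearMap.toSpanSingleton ℝ u).iteratedFDeriv_comp_right hV t le_rfl
  rw [iteratedDeriv_eq_iteratedFDeriv]
  change iteratedFDeriv ℝ n ((fun y => U (c + y)) ∘ ContinuousLinearMap.toSpanSingleton ℝ u) t _ = _
  rw [h, iteratedFDeriv_comp_add_left]
  simp

/-- Central difference error bound along a direction `u`. -/
theorem abs_sub_sub_inner_gradient_le_s11 [CompleteSpace E] {U : E → ℝ} (hU : ContDiff ℝ 3 U) {K : ℝ}
    (hK : ∀ x a b c : E, |iteratedFDeriv ℝ 3 U x ![a, b, c]| ≤ K * ‖a‖ * ‖b‖ * ‖c‖) (c u : E) :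
    |U (c + u) - U (c - u) - 2 * inner ℝ (gradient U c) u| ≤ K * ‖u‖ ^ 3 / 3 := by
  have hf : ContDiff ℝ 3 fun s : ℝ => U (c + s • u) :=
    hU.comp (contDiff_const.add (contDiff_id.smul contDiff_const))
  have hbound (t : ℝ) : |iteratedDeriv 3 (fun s : ℝ => U (c + s • u)) t| ≤ K * ‖u‖ ^ 3 := by
    rw [iteratedDeriv_comp_line hU]
    have hu : (fun _ : Fin 3 => u) = ![u, u, u] := by
      ext i; fin_cases i <;> rfl
    rw [hu]
    exact (hK _ u u u).trans_eq (by ring)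
  have hderiv : deriv (fun s : ℝ => U (c + s • u)) 0 = inner ℝ (gradient U c) u := by
    rw [inner_gradient_left]
    have hc : HasDerivAt (fun s : ℝ => c + s • u) u 0 := by
      simpa using ((hasDerivAt_id (0 : ℝ)).smul_const u).const_add c
    have hd : HasFDerivAt U (fderiv ℝ U c) (c + (0 : ℝ) • u) := by
      simpa using (hU.differentiable (by norm_num) c).hasFDerivAt
    exact (hd.comp_hasDerivAt 0 hc).deriv
  have h := abs_central_difference_le hf hbound
  rw [hderiv] at h
  simpa [sub_eq_add_neg] using h

/-- Decomposition of the Verlet energy error in terms of the mean velocity `w`, with `g` the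
gradient at the position after the first half drift. -/
theorem abs_verlet_energy_error_le [CompleteSpace E] {U : E → ℝ} {L K h : ℝ}
    (hU : ContDiff ℝ 3 U) (hh : 0 < h)
    (hLip : ∀ x y, ‖gradient U x - gradient U y‖ ≤ L * ‖x - y‖)
    (hK : ∀ x a b c : E, |iteratedFDeriv ℝ 3 U x ![a, b, c]| ≤ K * ‖a‖ * ‖b‖ * ‖c‖)
    (x v g w : E) (hg : g = gradient U (x + (h / 2) • v)) (hw : w = v - (h / 2) • g) :
    |‖v - h • g‖ ^ 2 / 2 + U (x + (h / 2) • v + (h / 2) • (v - h • g)) - (‖v‖ ^ 2 / 2 + U x)| ≤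
      K * h ^ 3 * ‖w‖ ^ 3 / 24 + L * h ^ 3 / 4 * (‖g‖ * ‖w‖) := by
  set m := x + (h / 2) • v with hm
  set c := m - (h ^ 2 / 4) • g with hc
  have hplus : m + (h / 2) • (v - h • g) = c + (h / 2) • w := by
    rw [hc, hw]; module
  have hminus : x = c - (h / 2) • w := by
    rw [hc, hw, hm]; module
  have hkin : ‖v - h • g‖ ^ 2 / 2 - ‖v‖ ^ 2 / 2 = -(h * inner ℝ g w) := by
    rw [hw, norm_sub_sq_real, norm_smul, inner_sub_right, inner_smul_right, inner_smul_right,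
      real_inner_self_eq_norm_sq, real_inner_comm, mul_pow, Real.norm_eq_abs, sq_abs]
    ring
  have hdiff := abs_sub_sub_inner_gradient_le_s11 hU hK c ((h / 2) • w)
  rw [inner_smul_right, norm_smul, Real.norm_of_nonneg (by positivity)] at hdiff
  have hgrad : |inner ℝ (gradient U c - g) w| ≤ L * (h ^ 2 / 4 * ‖g‖) * ‖w‖ := by
    refine (abs_real_inner_le_norm _ _).trans ?_
    gcongr
    have := hLip c m
    rw [← hg] at this
    refine this.trans_eq ?_
    rw [show c - m = -((h ^ 2 / 4) • g) by rw [hc]; abel, norm_neg, norm_smul,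
      Real.norm_of_nonneg (by positivity)]
  rw [inner_sub_left] at hgrad
  have hgrad' := mul_le_mul_of_nonneg_left hgrad hh.le
  have hx : U x = U (c - (h / 2) • w) := congrArg U hminus
  rw [hplus, hx]
  calc _ = |(U (c + (h / 2) • w) - U (c - (h / 2) • w) -
          2 * (h / 2 * inner ℝ (gradient U c) w)) +
          h * (inner ℝ (gradient U c) w - inner ℝ g w)| := by
        congr 1; linarith
    _ ≤ _ := abs_add_le _ _
    _ ≤ K * (h / 2 * ‖w‖) ^ 3 / 3 + h * (L * (h ^ 2 / 4 * ‖g‖) * ‖w‖) := by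
        rw [abs_mul, abs_of_pos hh]
        exact add_le_add hdiff hgrad'
    _ = _ := by ring

end InnerProductSpace

/-- Higher-order energy error bound for the Verlet integrator:
if `U ∈ C³` has global minimum `U(0) = 0`, `L`-Lipschitz gradient, `L_H`-bounded third
derivative, and `L h² ≤ 1`, then `|ΔH(z)| ≤ 2 L_H h³ ℰ(z)^{3/2} + L^{3/2} h³ ℰ(z)`. -/
theorem energy_error_high_order (d : ℕ) (U : EuclideanSpace ℝ (Fin d) → ℝ) (L L_H h : ℝ)
    (hU : ContDiff ℝ 3 U) (hL : 0 < L) (hLH : 0 ≤ L_H) (hh : 0 < h)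
    (hmin : ∀ x, U 0 ≤ U x) (hU0 : U 0 = 0)
    (hLip : ∀ x y, ‖gradient U x - gradient U y‖ ≤ L * ‖x - y‖)
    (hHess : ∀ x a b c : EuclideanSpace ℝ (Fin d),
      |iteratedFDeriv ℝ 3 U x ![a, b, c]| ≤ L_H * ‖a‖ * ‖b‖ * ‖c‖)
    (hLh : L * h ^ 2 ≤ 1)
    (z : EuclideanSpace ℝ (Fin d) × EuclideanSpace ℝ (Fin d)) :
    |Ham U (verlet U h z) - Ham U z| ≤
      2 * L_H * h ^ 3 * calE U L z ^ ((3 : ℝ) / 2) + L ^ ((3 : ℝ) / 2) * h ^ 3 * calE U L z := by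
  obtain ⟨x, v⟩ := z
  set s := √L with hs
  have hs0 : 0 < s := Real.sqrt_pos.2 hL
  have hsq : s ^ 2 = L := Real.sq_sqrt hL.le
  have hsh : s * h ≤ 1 := by
    refine (sq_le_one_iff₀ (by positivity)).1 ?_
    rwa [mul_pow, hsq]
  set g := gradient U (x + (h / 2) • v) with hg
  set w := v - (h / 2) • g with hw
  have hmain := abs_verlet_energy_error_le hU hh hLip hHess x v g w hg hw
  set e := calE U L (x, v) with he
  set a := ‖v‖ with ha
  set b := ‖gradient U x‖ / s with hb
  have hb' : ‖gradient U x‖ = s * b := by rw [hb]; field_simp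
  have ha0 : 0 ≤ a := norm_nonneg _
  have hb0 : 0 ≤ b := by positivity
  have he' : e = a ^ 2 + b ^ 2 := by
    rw [he, calE, hb', ← hsq, ha]
    field_simp
  have he0 : 0 ≤ e := by rw [he']; positivity
  have hgn : ‖g‖ ≤ s * (b + a / 2) := by
    have h₁ := hLip (x + (h / 2) • v) x
    rw [add_sub_cancel_left, norm_smul, Real.norm_of_nonneg (by positivity), ← hg, ← ha] at h₁
    have h₂ := norm_le_norm_add_norm_sub (gradient U x) g
    rw [hb', norm_sub_rev] at h₂
    have h₃ : L * (h / 2 * a) ≤ s * (a / 2) := by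
      rw [← hsq]
      nlinarith [mul_le_mul_of_nonneg_left hsh (by positivity : 0 ≤ s * (a / 2))]
    linarith
  have hwn : ‖w‖ ≤ 5 / 4 * a + b / 2 := by
    have h₁ := norm_sub_le v ((h / 2) • g)
    rw [norm_smul, Real.norm_of_nonneg (by positivity)] at h₁
    have h₂ : h / 2 * ‖g‖ ≤ h / 2 * (s * (b + a / 2)) := by gcongr
    have h₃ := mul_le_mul_of_nonneg_right hsh (by positivity : 0 ≤ (b + a / 2) / 2)
    linarith
  have hwe : ‖w‖ ≤ 2 * √e := by
    rw [← Real.sqrt_sq (zero_le_two (α := ℝ)), ← Real.sqrt_mul (by positivity)]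
    refine hwn.trans (Real.le_sqrt_of_sq_le ?_)
    rw [he']
    nlinarith [sq_nonneg (a - b), sq_nonneg (a - 2 * b)]
  have hpow (y : ℝ) (hy : 0 ≤ y) : y ^ ((3 : ℝ) / 2) = √y ^ 3 := by
    rw [Real.sqrt_eq_rpow, ← Real.rpow_natCast, ← Real.rpow_mul hy]
    norm_num
  rw [hpow e he0, hpow L hL.le, ← hs]
  have hgw : ‖g‖ * ‖w‖ ≤ s * (4 * e) := by
    calc ‖g‖ * ‖w‖ ≤ s * (b + a / 2) * (5 / 4 * a + b / 2) := by gcongr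
      _ = s * ((b + a / 2) * (5 / 4 * a + b / 2)) := by ring
      _ ≤ s * (4 * e) := by
        refine mul_le_mul_of_nonneg_left ?_ hs0.le
        rw [he']
        nlinarith [sq_nonneg (a - b)]
  refine hmain.trans (add_le_add ?_ ?_)
  · calc L_H * h ^ 3 * ‖w‖ ^ 3 / 24 ≤ L_H * h ^ 3 * (2 * √e) ^ 3 / 24 := by gcongr
      _ ≤ 2 * L_H * h ^ 3 * √e ^ 3 := by
        have : 0 ≤ L_H * h ^ 3 * √e ^ 3 := by positivity
        linarith
  · calc L * h ^ 3 / 4 * (‖g‖ * ‖w‖) ≤ L * h ^ 3 / 4 * (s * (4 * e)) := by gcongr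
      _ = s ^ 3 * h ^ 3 * e := by rw [← hsq]; ring
end

section
/- Let U : ℝ^d → ℝ be measurable, γ, h > 0, and δ = 1/8. Then for every z' ∈ ℝ^{2d}, 𝔼_{ξ ~ N(0,I_d)} exp( δ·[ H(O_{h/2}(ξ)(z')) − H(z') ] ) ≤ e^{δ·γ·h·d}. -/
open Real MeasureTheory

open GaussianFourier in
/-- The Gaussian integral `∫ exp (-b ‖x - m‖²)` as a lower Lebesgue integral. -/
theorem lintegral_exp_neg_mul_sq_norm_sub (d : ℕ) {b : ℝ} (hb : 0 < b)
    (m : EuclideanSpace ℝ (Fin d)) :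
    ∫⁻ x, ENNReal.ofReal (Real.exp (-b * ‖x - m‖ ^ 2)) =
      ENNReal.ofReal ((Real.pi / b) ^ ((d : ℝ) / 2)) := by
  rw [lintegral_sub_right_eq_self
    (fun x : EuclideanSpace ℝ (Fin d) => ENNReal.ofReal (Real.exp (-b * ‖x‖ ^ 2))) m]
  have hval : ∫ x : EuclideanSpace ℝ (Fin d), Real.exp (-b * ‖x‖ ^ 2) =
      (Real.pi / b) ^ ((d : ℝ) / 2) := by
    simpa using integral_rexp_neg_mul_sq_norm (V := EuclideanSpace ℝ (Fin d)) hb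
  have hint : Integrable fun x : EuclideanSpace ℝ (Fin d) => Real.exp (-b * ‖x‖ ^ 2) := by
    refine Integrable.of_integral_ne_zero ?_
    rw [hval]
    positivity
  rw [← hval, ofReal_integral_eq_lintegral_ofReal hint (ae_of_all _ fun x => (Real.exp_pos _).le)]

theorem exp_neg_div_four_le (t : ℝ) (ht : 0 ≤ t) :
    Real.exp (-(t / 4)) ≤ 1 - (1 - Real.exp (-t)) / 8 := by
  have hy : Real.exp (-t) = Real.exp (-(t / 4)) ^ 4 := by
    rw [← Real.exp_nat_mul]
    congr 1
    push_cast
    ring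
  have hy0 := Real.exp_pos (-(t / 4))
  have hy1 : Real.exp (-(t / 4)) ≤ 1 := Real.exp_le_one_iff.2 (by linarith)
  rw [hy]
  generalize Real.exp (-(t / 4)) = y at *
  nlinarith [sq_nonneg (y - 1), sq_nonneg (y ^ 2 - 1)]

/-- Completing the square in the exponent of the tilted Gaussian density. -/
theorem tilted_exponent_le {E : Type*} [NormedAddCommGroup E] [InnerProductSpace ℝ E]
    {p q : ℝ} (hpq : p ^ 2 + q ^ 2 = 1) (v x : E) :
    -‖x‖ ^ 2 / 2 + (1 / 8) * (‖p • v + q • x‖ ^ 2 / 2 - ‖v‖ ^ 2 / 2) ≤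
      -((1 - q ^ 2 / 8) / 2) * ‖x - (p * q / (8 * (1 - q ^ 2 / 8))) • v‖ ^ 2 := by
  have hB : 0 < 1 - q ^ 2 / 8 := by nlinarith [sq_nonneg p]
  have h : (p * q / 8) ^ 2 / (1 - q ^ 2 / 8) ≤ q ^ 2 / 8 := by
    rw [div_le_iff₀ hB]
    nlinarith [sq_nonneg p, sq_nonneg q, mul_nonneg (sq_nonneg p) (sq_nonneg q)]
  have hv := mul_le_mul_of_nonneg_right h (sq_nonneg ‖v‖)
  rw [norm_sub_sq_real, norm_add_sq_real]
  simp only [norm_smul, mul_pow, Real.norm_eq_abs, sq_abs, inner_smul_left, inner_smul_right,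
    conj_trivial, real_inner_comm x v]
  have hp : p ^ 2 = 1 - q ^ 2 := by linarith
  have key : -((1 - q ^ 2 / 8) / 2) * (‖x‖ ^ 2 -
        2 * (p * q / (8 * (1 - q ^ 2 / 8)) * inner ℝ x v) +
        (p * q / (8 * (1 - q ^ 2 / 8))) ^ 2 * ‖v‖ ^ 2) =
      -((1 - q ^ 2 / 8) / 2) * ‖x‖ ^ 2 + p * q / 8 * inner ℝ x v
        - (p * q / 8) ^ 2 / (1 - q ^ 2 / 8) * ‖v‖ ^ 2 / 2 := by
    have := hB.ne'
    generalize 1 - q ^ 2 / 8 = B at *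
    field_simp
    ring
  rw [key, hp]
  linarith

/-- inequality `stabgreenstar`: with `δ = 1/8`, for every `z'`,
`𝔼_{ξ∼N(0,I_d)} exp(δ[H(O_{h/2}(ξ)(z')) − H(z')]) ≤ e^{δγhd}`. -/
theorem OU_exponential_moment_bound (d : ℕ) (U : EuclideanSpace ℝ (Fin d) → ℝ)
    (hUmeas : Measurable U) (γ h : ℝ) (hγ : 0 < γ) (hh : 0 < h)
    (z' : EuclideanSpace ℝ (Fin d) × EuclideanSpace ℝ (Fin d)) :
    ∫⁻ ξ, ENNReal.ofReal
        (Real.exp ((1 / 8) * (Ham U (OUhalf γ h ξ z') - Ham U z'))) ∂(stdGaussian d) ≤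
      ENNReal.ofReal (Real.exp ((1 / 8) * (γ * h * d))) := by
  have ht : 0 < γ * h := mul_pos hγ hh
  have he : Real.exp (-(γ * h)) < 1 := Real.exp_lt_one_iff.2 (by linarith)
  set p := Real.exp (-(γ * h) / 2) with hp
  set q := Real.sqrt (1 - Real.exp (-(γ * h))) with hq
  have hq2 : q ^ 2 = 1 - Real.exp (-(γ * h)) := Real.sq_sqrt (by linarith)
  have hp2 : p ^ 2 = Real.exp (-(γ * h)) := by
    rw [hp, ← Real.exp_nat_mul]
    congr 1
    push_cast
    ring
  have hB : 0 < 1 - q ^ 2 / 8 := by linarith [Real.exp_pos (-(γ * h))]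
  have hC : 0 ≤ (2 * Real.pi) ^ (-(d : ℝ) / 2) := by positivity
  set m := (p * q / (8 * (1 - q ^ 2 / 8))) • z'.2
  calc _ ≤ ∫⁻ x, ENNReal.ofReal ((2 * Real.pi) ^ (-(d : ℝ) / 2)) *
        ENNReal.ofReal (Real.exp (-((1 - q ^ 2 / 8) / 2) * ‖x - m‖ ^ 2)) := by
        rw [stdGaussian, lintegral_withDensity_eq_lintegral_mul_non_measurable _ (by fun_prop)
          (ae_of_all _ fun x => ENNReal.ofReal_lt_top)]
        refine lintegral_mono fun x => ?_
        simp only [Pi.mul_apply]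
        rw [← ENNReal.ofReal_mul (by positivity), ← ENNReal.ofReal_mul hC, mul_assoc,
          ← Real.exp_add]
        gcongr
        have := tilted_exponent_le (p := p) (q := q) (by linarith) z'.2 x
        simpa only [Ham, OUhalf, add_sub_add_right_eq_sub] using this
    _ = ENNReal.ofReal ((2 * Real.pi) ^ (-(d : ℝ) / 2) *
        (Real.pi / ((1 - q ^ 2 / 8) / 2)) ^ ((d : ℝ) / 2)) := by
        rw [lintegral_const_mul' _ _ ENNReal.ofReal_ne_top,
          lintegral_exp_neg_mul_sq_norm_sub d (half_pos hB), ENNReal.ofReal_mul hC]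
    _ ≤ _ := by
        refine ENNReal.ofReal_le_ofReal ?_
        have h1 : (2 * Real.pi) ^ (-(d : ℝ) / 2) *
            (Real.pi / ((1 - q ^ 2 / 8) / 2)) ^ ((d : ℝ) / 2) =
            ((1 - q ^ 2 / 8)⁻¹) ^ ((d : ℝ) / 2) := by
          rw [neg_div, Real.rpow_neg (by positivity), ← Real.inv_rpow (by positivity),
            ← Real.mul_rpow (by positivity) (by positivity)]
          congr 1
          have := hB.ne'
          field_simp
        have h2 : (1 - q ^ 2 / 8)⁻¹ ≤ Real.exp (γ * h / 4) := by
          rw [← inv_inv (Real.exp (γ * h / 4)), ← Real.exp_neg, hq2]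
          exact inv_anti₀ (Real.exp_pos _) (exp_neg_div_four_le _ ht.le)
        rw [h1]
        refine (Real.rpow_le_rpow (by positivity) h2 (by positivity)).trans_eq ?_
        rw [← Real.exp_mul]
        congr 1
        ring
end

section
/- Suppose U has a global minimum at 0 with U(0) = 0 and L-Lipschitz gradient, U ∈ C³ with |∇³U(x)⋮(a⊗b⊗c)| ≤ L_H|a||b||c| for all x,a,b,c ∈ ℝ^d, and Lh² ≤ 1. Then for every R_U > 0 and every z ∈ ℝ^{2d} with ℰ(z) ≤ R_U, the rejection probability of the MAKLA transition from z satisfies 𝔼_{ξ ~ N(0,I_d)}[ 1 − exp(−max(0, ΔH(O_{h/2}(ξ)(z)))) ] ≤ h³·( 8·L_H·(R_U^{3/2} + 3·(γhd)^{3/2}) + L^{3/2}·(R_U + γhd) ). -/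
open Real MeasureTheory

/-- The energy error `ΔH = H ∘ θ_h − H`. -/
noncomputable def deltaH {d : ℕ} (U : EuclideanSpace ℝ (Fin d) → ℝ) (h : ℝ)
    (z : EuclideanSpace ℝ (Fin d) × EuclideanSpace ℝ (Fin d)) : ℝ :=
  Ham U (verlet U h z) - Ham U z

/-- Quadratic Taylor bound for a function with bounded third derivative. -/
lemma abs_sub_taylor_two_le {E : Type*} [NormedAddCommGroup E] [NormedSpace ℝ E]
    {U : E → ℝ} {K : ℝ} (hU : ContDiff ℝ 3 U)
    (hK : ∀ x, ‖iteratedFDeriv ℝ 3 U x‖ ≤ K) (y w : E) :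
    |U (y + w) - (U y + fderiv ℝ U y w + fderiv ℝ (fderiv ℝ U) y w w / 2)| ≤
      K * ‖w‖ ^ 3 / 6 := by
  have htaylor := map_add_eq_sum_add_integral_iteratedFDeriv (n := 2) (f := U) (x := y) (y := w)
    fun t _ => by exact_mod_cast hU.contDiffAt
  have hrem : ‖∫ t in (0 : ℝ)..1, (1 - t) ^ 2 •
      iteratedFDeriv ℝ 3 U (y + t • w) (fun _ => w)‖ ≤
      ∫ t in (0 : ℝ)..1, (1 - t) ^ 2 * (K * ‖w‖ ^ 3) := by
    refine intervalIntegral.norm_integral_le_of_norm_le zero_le_one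
      (Filter.Eventually.of_forall fun t _ => ?_) (Continuous.intervalIntegrable (by fun_prop) _ _)
    rw [norm_smul, Real.norm_eq_abs ((1 - t) ^ 2), abs_of_nonneg (sq_nonneg _)]
    gcongr
    simpa using (iteratedFDeriv ℝ 3 U (y + t • w)).le_of_opNorm_le (hK _) (fun _ => w)
  have hint : ∫ t in (0 : ℝ)..1, (1 - t) ^ 2 * (K * ‖w‖ ^ 3) = K * ‖w‖ ^ 3 / 3 := by
    rw [intervalIntegral.integral_mul_const,
      intervalIntegral.integral_comp_sub_left (fun t : ℝ => t ^ 2)]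
    norm_num
    ring
  rw [hint, Real.norm_eq_abs] at hrem
  simp only [Finset.sum_range_succ, Finset.sum_range_zero, iteratedFDeriv_zero_apply,
    iteratedFDeriv_one_apply, iteratedFDeriv_two_apply, smul_eq_mul] at htaylor
  norm_num at htaylor hrem
  rw [htaylor]
  calc _ = |(1 / 2) * ∫ t in (0 : ℝ)..1, (1 - t) ^ 2 *
        iteratedFDeriv ℝ 3 U (y + t • w) (fun _ => w)| := by congr 1; ring
    _ ≤ (1 / 2) * (K * ‖w‖ ^ 3 / 3) := by rw [abs_mul, abs_of_pos (by norm_num)]; gcongr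
    _ = _ := by ring

/-- Comparison with an exponential moment under the standard Gaussian measure. -/
lemma lintegral_stdGaussian_le {d : ℕ} (hd : 0 < d) {A B : ℝ} (hA : 0 ≤ A) (hB : 0 ≤ B)
    {f : EuclideanSpace ℝ (Fin d) → ℝ}
    (hf : ∀ x, f x ≤ A + B * (Real.exp (‖x‖ ^ 2 / (8 * d)) - 1)) :
    ∫⁻ x, ENNReal.ofReal (f x) ∂(stdGaussian d) ≤ ENNReal.ofReal (A + B / 6) := by
  have hd1 : (1 : ℝ) ≤ d := by exact_mod_cast hd
  have hinv : 1 / (8 * (d : ℝ)) ≤ 1 / 8 := by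
    gcongr; linarith
  set b : ℝ := 1 / 2 - 1 / (8 * d) with hb
  have hb0 : 0 < b := by linarith
  set C : ℝ := (2 * π) ^ (-(d : ℝ) / 2) with hC
  have hC0 : 0 < C := by positivity
  have hint : ∀ c : ℝ, 0 < c → Integrable (fun x : EuclideanSpace ℝ (Fin d) =>
      Real.exp (-c * ‖x‖ ^ 2)) := fun c hc => by
    by_contra hcon
    have h1 := GaussianFourier.integral_rexp_neg_mul_sq_norm (V := EuclideanSpace ℝ (Fin d)) hc
    rw [integral_undef hcon] at h1
    have : 0 < (π / c) ^ (Module.finrank ℝ (EuclideanSpace ℝ (Fin d)) / 2 : ℝ) := by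
      positivity
    linarith
  have hmass : C * (π / (1 / 2)) ^ ((d : ℝ) / 2) = 1 := by
    rw [hC, show π / (1 / 2) = 2 * π by ring, ← Real.rpow_add (by positivity)]
    rw [show -(d : ℝ) / 2 + d / 2 = 0 by ring, Real.rpow_zero]
  have hexp : C * (π / b) ^ ((d : ℝ) / 2) ≤ 7 / 6 := by
    have hq : π / b = (π / (1 / 2)) * (2 * b)⁻¹ := by field_simp
    have hbern : 3 / 4 ≤ (2 * b) ^ d := by
      have := one_add_mul_le_pow (a := -(1 / (4 * (d : ℝ)))) (by
        have : 1 / (4 * (d : ℝ)) ≤ 1 / 4 := by gcongr; linarith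
        linarith) d
      calc (3 / 4 : ℝ) = 1 + d * (-(1 / (4 * (d : ℝ)))) := by field_simp; norm_num
        _ ≤ _ := this
        _ = _ := by congr 1; rw [hb]; field_simp; ring
    rw [hq, Real.mul_rpow (by positivity) (by positivity), ← mul_assoc, hmass, one_mul]
    refine (sq_le_sq₀ (by positivity) (by norm_num)).1 ?_
    calc (((2 * b)⁻¹ : ℝ) ^ ((d : ℝ) / 2)) ^ 2 = ((2 * b) ^ d)⁻¹ := by
          rw [← Real.rpow_natCast, ← Real.rpow_mul (by positivity)]
          push_cast
          rw [div_mul_cancel₀ _ two_ne_zero, Real.rpow_natCast, inv_pow]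
      _ ≤ (3 / 4)⁻¹ := by gcongr
      _ ≤ (7 / 6) ^ 2 := by norm_num
  have hdens : ∀ x : EuclideanSpace ℝ (Fin d),
      C * Real.exp (-‖x‖ ^ 2 / 2) * (A + B * (Real.exp (‖x‖ ^ 2 / (8 * d)) - 1)) =
        C * (A - B) * Real.exp (-(1 / 2) * ‖x‖ ^ 2) + C * B * Real.exp (-b * ‖x‖ ^ 2) := fun x => by
    rw [show -b * ‖x‖ ^ 2 = -‖x‖ ^ 2 / 2 + ‖x‖ ^ 2 / (8 * d) by rw [hb]; ring, Real.exp_add,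
      show -(1 / 2) * ‖x‖ ^ 2 = -‖x‖ ^ 2 / 2 by ring]
    ring
  calc ∫⁻ x, ENNReal.ofReal (f x) ∂(stdGaussian d)
      ≤ ∫⁻ x, ENNReal.ofReal (A + B * (Real.exp (‖x‖ ^ 2 / (8 * d)) - 1)) ∂(stdGaussian d) :=
        lintegral_mono fun x => ENNReal.ofReal_le_ofReal (hf x)
    _ = ∫⁻ x, ENNReal.ofReal (C * (A - B) * Real.exp (-(1 / 2) * ‖x‖ ^ 2) +
          C * B * Real.exp (-b * ‖x‖ ^ 2)) := by
        rw [stdGaussian, lintegral_withDensity_eq_lintegral_mul _ (by fun_prop) (by fun_prop)]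
        refine lintegral_congr fun x => ?_
        rw [Pi.mul_apply, ← ENNReal.ofReal_mul (by positivity), hdens]
    _ = ENNReal.ofReal (∫ x : EuclideanSpace ℝ (Fin d),
          (C * (A - B) * Real.exp (-(1 / 2) * ‖x‖ ^ 2) + C * B * Real.exp (-b * ‖x‖ ^ 2))) := by
        rw [ofReal_integral_eq_lintegral_ofReal]
        · exact ((hint _ (by norm_num)).const_mul _).add ((hint _ hb0).const_mul _)
        · refine Filter.Eventually.of_forall fun x => ?_
          have : 1 ≤ Real.exp (‖x‖ ^ 2 / (8 * d)) := Real.one_le_exp (by positivity)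
          simp only [Pi.zero_apply, ← hdens x]
          have := mul_nonneg hB (sub_nonneg.2 this)
          positivity
    _ ≤ ENNReal.ofReal (A + B / 6) := by
        refine ENNReal.ofReal_le_ofReal ?_
        rw [integral_add ((hint _ (by norm_num)).const_mul _) ((hint _ hb0).const_mul _),
          integral_const_mul, integral_const_mul,
          GaussianFourier.integral_rexp_neg_mul_sq_norm (by norm_num),
          GaussianFourier.integral_rexp_neg_mul_sq_norm hb0, finrank_euclideanSpace_fin]
        have := mul_le_mul_of_nonneg_left hexp hB
        linear_combination (A - B) * hmass + this

/-- Energy error of one velocity Verlet step, in terms of the midpoint gradient. -/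
lemma deltaH_le {d : ℕ} {U : EuclideanSpace ℝ (Fin d) → ℝ} {L K h : ℝ}
    (hU : ContDiff ℝ 3 U) (hL : 0 ≤ L) (hh : 0 ≤ h)
    (hLip : ∀ x y, ‖gradient U x - gradient U y‖ ≤ L * ‖x - y‖)
    (hK : ∀ x, ‖iteratedFDeriv ℝ 3 U x‖ ≤ K) (x v : EuclideanSpace ℝ (Fin d)) :
    deltaH U h (x, v) ≤
      L * h ^ 3 / 4 * ‖gradient U (x + (h / 2) • v)‖ * ‖v‖
        + L * h ^ 4 / 8 * ‖gradient U (x + (h / 2) • v)‖ ^ 2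
        + K * h ^ 3 / 48 * (‖v‖ ^ 3 + ‖v - h • gradient U (x + (h / 2) • v)‖ ^ 3) := by
  set y := x + (h / 2) • v with hy
  set g := gradient U y with hg
  have hgrad : ∀ w, fderiv ℝ U y w = inner ℝ g w := fun w => by
    rw [hg, gradient, InnerProductSpace.toDual_symm_apply]
  have hB : ‖fderiv ℝ (fderiv ℝ U) y‖ ≤ L := by
    refine norm_fderiv_le_of_lip' ℝ hL (Filter.Eventually.of_forall fun u => ?_)
    have := hLip u y
    rwa [gradient, gradient, ← map_sub, LinearIsometryEquiv.norm_map] at this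
  set B := fderiv ℝ (fderiv ℝ U) y with hBdef
  have hBle : ∀ a b, |B a b| ≤ L * ‖a‖ * ‖b‖ := fun a b =>
    (B.le_opNorm₂ a b).trans (by gcongr)
  have h1 := (abs_le.1 (abs_sub_taylor_two_le hU hK y ((h / 2) • (v - h • g)))).2
  have h2 := (abs_le.1 (abs_sub_taylor_two_le hU hK y (-((h / 2) • v)))).1
  rw [show y + -((h / 2) • v) = x by rw [hy]; abel] at h2
  have hvv := abs_le.1 (hBle g v)
  have hvv' := abs_le.1 (hBle v g)
  have hgg := abs_le.1 (hBle g g)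
  rw [hgrad] at h1 h2
  rw [← hBdef] at h1 h2
  have hkin : ‖v - h • g‖ ^ 2 = ‖v‖ ^ 2 - 2 * h * inner ℝ g v + h ^ 2 * ‖g‖ ^ 2 := by
    rw [norm_sub_sq_real, norm_smul, inner_smul_right, real_inner_comm, mul_pow,
      Real.norm_eq_abs, sq_abs]
    ring
  simp only [inner_smul_right, inner_sub_right, inner_neg_right, map_smul, map_sub, map_neg,
    smul_apply, sub_apply, neg_apply,
    smul_eq_mul, norm_smul, norm_neg, real_inner_self_eq_norm_sq, Real.norm_eq_abs,
    abs_of_nonneg (show 0 ≤ h / 2 by positivity), mul_pow] at h1 h2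
  simp only [deltaH, Ham, verlet, ← hy, ← hg, hkin]
  have e1 := mul_le_mul_of_nonneg_left hvv.1 (show 0 ≤ h ^ 3 / 8 by positivity)
  have e2 := mul_le_mul_of_nonneg_left hvv'.1 (show 0 ≤ h ^ 3 / 8 by positivity)
  have e3 := mul_le_mul_of_nonneg_left hgg.2 (show 0 ≤ h ^ 4 / 8 by positivity)
  linarith

/-- Real-variable estimate combining the Verlet energy error with an Ornstein–Uhlenbeck velocity:
`s` bounds the rescaled midpoint gradient, `q` the velocity, and `q'` the velocity after the step. -/
lemma energy_error_estimate {ℓ K r κ τ p G q s q' e : ℝ}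
    (hℓ : 0 ≤ ℓ) (hK : 0 ≤ K) (hr : 0 ≤ r) (hκ : 0 ≤ κ) (hτ : 0 ≤ τ)
    (hq : 0 ≤ q) (hs : 0 ≤ s) (hq' : 0 ≤ q')
    (hpG : p ^ 2 + G ^ 2 ≤ r ^ 2) (hqle : q ≤ p + κ * τ) (hsle : s ≤ G + q / 2)
    (hq'le : q' ≤ q + s) (he : Real.exp (τ ^ 2 / 8) - 1 = e) :
    ℓ ^ 3 / 4 * s * q + ℓ ^ 3 / 8 * s ^ 2 + K / 48 * (q ^ 3 + q' ^ 3) ≤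
      K * (2 * r ^ 3 + 80 * κ ^ 3 * e) + ℓ ^ 3 * (r ^ 2 + 5 * κ ^ 2 * e) := by
  have hexp := Real.quadratic_le_exp_of_nonneg (show 0 ≤ τ ^ 2 / 8 by positivity)
  have hτ2 : τ ^ 2 ≤ 8 * e := by nlinarith [sq_nonneg (τ ^ 2)]
  have hτ3 : τ ^ 3 ≤ 64 * e := by nlinarith [sq_nonneg (τ * (τ - 1))]
  have hpr : p ≤ r := by nlinarith
  have hGr : G ≤ r := by nlinarith
  have add_pow_three_le : ∀ a b : ℝ, 0 ≤ a → 0 ≤ b → (a + b) ^ 3 ≤ 4 * (a ^ 3 + b ^ 3) :=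
    fun a b ha hb => by nlinarith [mul_nonneg (add_nonneg ha hb) (sq_nonneg (a - b))]
  have hq3 : q ^ 3 ≤ 4 * (r ^ 3 + κ ^ 3 * (64 * e)) := by
    calc q ^ 3 ≤ (r + κ * τ) ^ 3 := by gcongr; linarith
      _ ≤ 4 * (r ^ 3 + (κ * τ) ^ 3) := add_pow_three_le _ _ hr (by positivity)
      _ ≤ _ := by rw [mul_pow]; gcongr
  have hq'3 : q' ^ 3 ≤ 4 * ((3 / 2 * q) ^ 3 + r ^ 3) := by
    calc q' ^ 3 ≤ (3 / 2 * q + r) ^ 3 := by gcongr; linarith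
      _ ≤ _ := add_pow_three_le _ _ (by positivity) hr
  have hcubic : (q ^ 3 + q' ^ 3) / 48 ≤ 2 * r ^ 3 + 80 * κ ^ 3 * e := by
    have : 0 ≤ r ^ 3 := by positivity
    have : 0 ≤ κ ^ 3 * e := mul_nonneg (by positivity) (by nlinarith [sq_nonneg τ])
    linarith
  have hq2 : q ^ 2 ≤ 5 / 2 * p ^ 2 + 5 / 3 * (κ ^ 2 * (8 * e)) := by
    calc q ^ 2 ≤ (p + κ * τ) ^ 2 := by gcongr
      _ ≤ 5 / 2 * p ^ 2 + 5 / 3 * (κ ^ 2 * τ ^ 2) := by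
        nlinarith [sq_nonneg (3 * p - 2 * (κ * τ))]
      _ ≤ _ := by gcongr
  have hquad : s * q / 4 + s ^ 2 / 8 ≤ r ^ 2 + 5 * κ ^ 2 * e := by
    have : 0 ≤ κ ^ 2 * e := mul_nonneg (by positivity) (by nlinarith [sq_nonneg τ])
    have : s * q / 4 + s ^ 2 / 8 ≤ (G + q / 2) * q / 4 + (G + q / 2) ^ 2 / 8 := by gcongr
    nlinarith [sq_nonneg (G - q), sq_nonneg p, sq_nonneg G]
  have := mul_le_mul_of_nonneg_left hcubic hK
  have := mul_le_mul_of_nonneg_left hquad (pow_nonneg hℓ 3)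
  linarith

/-- The power `3 / 2` as the cube of the square root. -/
lemma rpow_three_halves_eq_sqrt_pow (x : ℝ) (hx : 0 ≤ x) : x ^ ((3 : ℝ) / 2) = √x ^ 3 := by
  rw [Real.sqrt_eq_rpow, ← Real.rpow_natCast, ← Real.rpow_mul hx]
  norm_num

/-- Rejection probability bound for one MAKLA transition from
`z` with `ℰ(z) ≤ R_U`:
`𝔼_ξ[1 − e^{−(ΔH(O_{h/2}(ξ)(z)))⁺}] ≤ h³(8 L_H (R_U^{3/2} + 3(γhd)^{3/2}) + L^{3/2}(R_U + γhd))`. -/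
theorem rejection_probability_bound (d : ℕ) (U : EuclideanSpace ℝ (Fin d) → ℝ)
    (L L_H γ h R_U : ℝ)
    (hU : ContDiff ℝ 3 U) (hL : 0 < L) (hLH : 0 ≤ L_H) (hγ : 0 < γ) (hh : 0 < h)
    (hmin : ∀ x, U 0 ≤ U x) (hU0 : U 0 = 0)
    (hLip : ∀ x y, ‖gradient U x - gradient U y‖ ≤ L * ‖x - y‖)
    (hHess : ∀ x a b c : EuclideanSpace ℝ (Fin d),
      |iteratedFDeriv ℝ 3 U x ![a, b, c]| ≤ L_H * ‖a‖ * ‖b‖ * ‖c‖)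
    (hLh : L * h ^ 2 ≤ 1) (hRU : 0 < R_U)
    (z : EuclideanSpace ℝ (Fin d) × EuclideanSpace ℝ (Fin d))
    (hz : calE U L z ≤ R_U) :
    ∫⁻ ξ, ENNReal.ofReal
        (1 - Real.exp (-(max 0 (deltaH U h (OUhalf γ h ξ z))))) ∂(stdGaussian d) ≤
      ENNReal.ofReal (h ^ 3 *
        (8 * L_H * (R_U ^ ((3 : ℝ) / 2) + 3 * (γ * h * d) ^ ((3 : ℝ) / 2))
          + L ^ ((3 : ℝ) / 2) * (R_U + γ * h * d))) := by
  rcases Nat.eq_zero_or_pos d with rfl | hd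
  · have hzero : ∀ w, deltaH U h w = 0 := fun w => by
      rw [deltaH, Subsingleton.elim (verlet U h w) w, sub_self]
    simp [hzero]
  have hd0 : (0 : ℝ) < d := by exact_mod_cast hd
  have hK : ∀ x, ‖iteratedFDeriv ℝ 3 U x‖ ≤ L_H := fun x =>
    ContinuousMultilinearMap.opNorm_le_bound hLH fun m => by
      have := hHess x (m 0) (m 1) (m 2)
      rw [show ![m 0, m 1, m 2] = m from List.ofFn_injective rfl] at this
      simpa [Fin.prod_univ_three, mul_assoc] using this
  obtain ⟨x, v₀⟩ := z
  have hγhd : 0 ≤ γ * h * d := by positivity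
  rw [rpow_three_halves_eq_sqrt_pow _ hRU.le, rpow_three_halves_eq_sqrt_pow _ hγhd,
    rpow_three_halves_eq_sqrt_pow _ hL.le]
  set r := √R_U
  set κ := √(γ * h * d) with hκ
  set ℓ := √L
  have hr2 : r ^ 2 = R_U := Real.sq_sqrt hRU.le
  have hκ2 : κ ^ 2 = γ * h * d := Real.sq_sqrt hγhd
  have hℓ2 : ℓ ^ 2 = L := Real.sq_sqrt hL.le
  have hℓ0 : 0 < ℓ := Real.sqrt_pos.2 hL
  have hr0 : 0 ≤ r := Real.sqrt_nonneg _
  have hκ0 : 0 ≤ κ := Real.sqrt_nonneg _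
  have hℓh : ℓ * h ≤ 1 := by
    rw [← sq_le_one_iff₀ (by positivity), mul_pow, hℓ2]
    exact hLh
  have hpoint : ∀ ξ : EuclideanSpace ℝ (Fin d),
      1 - Real.exp (-(max 0 (deltaH U h (OUhalf γ h ξ (x, v₀))))) ≤
        h ^ 3 * (2 * L_H * r ^ 3 + ℓ ^ 3 * r ^ 2) +
          h ^ 3 * (80 * L_H * κ ^ 3 + 5 * ℓ ^ 3 * κ ^ 2) *
            (Real.exp (‖ξ‖ ^ 2 / (8 * d)) - 1) := fun ξ => by
    have he : 0 ≤ Real.exp (‖ξ‖ ^ 2 / (8 * d)) - 1 :=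
      sub_nonneg.2 (Real.one_le_exp (by positivity))
    refine (sub_le_comm.1 (Real.one_sub_le_exp_neg _)).trans (max_le (by positivity) ?_)
    rw [OUhalf]
    set v := Real.exp (-(γ * h) / 2) • v₀ + √(1 - Real.exp (-(γ * h))) • ξ
    refine (deltaH_le hU hL.le hh.le hLip hK x v).trans ?_
    set g := gradient U (x + (h / 2) • v)
    have hg : ‖g‖ = ℓ * (‖g‖ / ℓ) := by field_simp
    have hpG : ‖v₀‖ ^ 2 + (‖gradient U x‖ / ℓ) ^ 2 ≤ r ^ 2 := by
      rw [hr2, div_pow, hℓ2, div_eq_inv_mul]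
      exact hz
    have hv : ‖v‖ ≤ ‖v₀‖ + κ * (‖ξ‖ / √d) := by
      have hκξ : κ * (‖ξ‖ / √d) = √(γ * h) * ‖ξ‖ := by
        rw [hκ, Real.sqrt_mul (by positivity)]
        field_simp
      refine (norm_add_le _ _).trans (add_le_add ?_ ?_)
      · rw [norm_smul, Real.norm_eq_abs, Real.abs_exp]
        exact mul_le_of_le_one_left (norm_nonneg _)
          (Real.exp_le_one_iff.2 (by linarith [mul_pos hγ hh]))
      · rw [norm_smul, Real.norm_eq_abs, abs_of_nonneg (Real.sqrt_nonneg _), hκξ]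
        gcongr
        linarith [Real.one_sub_le_exp_neg (γ * h)]
    have hs : ‖g‖ / ℓ ≤ ‖gradient U x‖ / ℓ + ‖v‖ / 2 := by
      have h1 := hLip (x + (h / 2) • v) x
      rw [add_sub_cancel_left, norm_smul, Real.norm_eq_abs, abs_of_pos (by positivity)] at h1
      have h2 := norm_le_norm_add_norm_sub' g (gradient U x)
      rw [div_le_iff₀ hℓ0, add_mul, div_mul_cancel₀ _ hℓ0.ne']
      have h3 := mul_le_mul_of_nonneg_left hℓh (show 0 ≤ ℓ * ‖v‖ / 2 by positivity)
      rw [← hℓ2] at h1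
      linarith
    have hv' : ‖v - h • g‖ ≤ ‖v‖ + ‖g‖ / ℓ := by
      refine (norm_sub_le _ _).trans ?_
      rw [norm_smul, Real.norm_eq_abs, abs_of_pos hh]
      gcongr
      rw [le_div_iff₀ hℓ0]
      have := mul_le_mul_of_nonneg_left hℓh (norm_nonneg g)
      linarith
    have hest := energy_error_estimate hℓ0.le hLH hr0 hκ0 (show 0 ≤ ‖ξ‖ / √d by positivity)
      (norm_nonneg v) (show 0 ≤ ‖g‖ / ℓ by positivity) (norm_nonneg (v - h • g)) hpG hv hs hv'
      (e := Real.exp (‖ξ‖ ^ 2 / (8 * d)) - 1)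
      (by rw [div_pow, Real.sq_sqrt hd0.le, div_div, mul_comm (d : ℝ) 8])
    have hest' := mul_le_mul_of_nonneg_left hest (pow_nonneg hh.le 3)
    have hsq := mul_le_mul_of_nonneg_left hℓh
      (show 0 ≤ h ^ 3 * ℓ ^ 3 / 8 * (‖g‖ / ℓ) ^ 2 by positivity)
    rw [hg, ← hℓ2]
    linarith
  refine (lintegral_stdGaussian_le hd (by positivity) (by positivity) hpoint).trans
    (ENNReal.ofReal_le_ofReal ?_)
  rw [← hr2, ← hκ2, mul_div_assoc, ← mul_add]
  refine mul_le_mul_of_nonneg_left ?_ (by positivity)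
  have : 0 ≤ L_H * r ^ 3 := by positivity
  have : 0 ≤ L_H * κ ^ 3 := by positivity
  have : 0 ≤ ℓ ^ 3 * κ ^ 2 := by positivity
  linarith
end

section
/- Let U : ℝ^d → ℝ be continuously differentiable, L, γ, h > 0, and ξ ~ N(0,I_d). Then for every z ∈ ℝ^{2d}: (a) 𝔼 ℰ(O_{h/2}(ξ)(z)) ≤ ℰ(z) + γ·h·d, and (b) 𝔼 ℰ(O_{h/2}(ξ)(z))^{3/2} ≤ 4·( ℰ(z)^{3/2} + 3·(γhd)^{3/2} ). -/
open Real MeasureTheory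

section GaussianMoments

open Module Set

variable {E : Type*} [NormedAddCommGroup E] [InnerProductSpace ℝ E] [FiniteDimensional ℝ E]
  [MeasurableSpace E] [BorelSpace E]

private lemma integrable_norm_pow_mul_exp (k : ℕ) :
    Integrable fun x : E => ‖x‖ ^ k * exp (-‖x‖ ^ 2 / 2) := by
  rcases subsingleton_or_nontrivial E with hE | hE
  · exact .of_finite
  · refine (integrable_fun_norm_addHaar volume
      (f := fun y : ℝ => y ^ k * exp (-y ^ 2 / 2))).2 ?_
    have hs : (-1 : ℝ) < ((finrank ℝ E - 1 + k : ℕ) : ℝ) :=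
      neg_one_lt_zero.trans_le (Nat.cast_nonneg _)
    refine (integrableOn_rpow_mul_exp_neg_mul_sq one_half_pos hs).congr_fun (fun y _ => ?_)
      measurableSet_Ioi
    simp only [rpow_natCast, smul_eq_mul, pow_add, mul_assoc]
    congr 3
    ring

private lemma integral_Ioi_pow_mul_exp (n : ℕ) :
    ∫ y in Ioi (0 : ℝ), y ^ n * exp (-y ^ 2 / 2) =
      (1 / 2 : ℝ) ^ (-((n : ℝ) + 1) / 2) * (1 / 2) * Gamma (((n : ℝ) + 1) / 2) := by
  rw [← integral_rpow_mul_exp_neg_mul_rpow two_pos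
    (by linarith [Nat.cast_nonneg (α := ℝ) n]) (by norm_num)]
  refine setIntegral_congr_fun measurableSet_Ioi fun y _ => ?_
  simp only [rpow_natCast, rpow_two]
  congr 2
  ring

private lemma integral_Ioi_pow_add_two_mul_exp (n : ℕ) :
    ∫ y in Ioi (0 : ℝ), y ^ (n + 2) * exp (-y ^ 2 / 2) =
      (n + 1) * ∫ y in Ioi (0 : ℝ), y ^ n * exp (-y ^ 2 / 2) := by
  have hn : (0 : ℝ) < ((n : ℝ) + 1) / 2 := by positivity
  rw [integral_Ioi_pow_mul_exp, integral_Ioi_pow_mul_exp,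
    show (((n + 2 : ℕ) : ℝ) + 1) / 2 = ((n : ℝ) + 1) / 2 + 1 by push_cast; ring,
    Gamma_add_one hn.ne',
    show -(((n + 2 : ℕ) : ℝ) + 1) / 2 = -((n : ℝ) + 1) / 2 + (-1) by push_cast; ring,
    rpow_add (by norm_num), rpow_neg_one]
  ring

private lemma integral_norm_pow_add_two_mul_exp (k : ℕ) :
    ∫ x : E, ‖x‖ ^ (k + 2) * exp (-‖x‖ ^ 2 / 2) =
      (finrank ℝ E + k) * ∫ x : E, ‖x‖ ^ k * exp (-‖x‖ ^ 2 / 2) := by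
  rcases subsingleton_or_nontrivial E with hE | hE
  · have h0 (x : E) : ‖x‖ = 0 := by rw [Subsingleton.elim x 0, norm_zero]
    rcases k with _ | k <;> simp [h0, finrank_zero_of_subsingleton]
  · rw [integral_fun_norm_addHaar volume (fun y : ℝ => y ^ (k + 2) * exp (-y ^ 2 / 2)),
      integral_fun_norm_addHaar volume (fun y : ℝ => y ^ k * exp (-y ^ 2 / 2))]
    simp only [smul_eq_mul, ← mul_assoc, ← pow_add, nsmul_eq_mul]
    rw [← add_assoc, integral_Ioi_pow_add_two_mul_exp]
    have : ((finrank ℝ E - 1 + k : ℕ) : ℝ) + 1 = finrank ℝ E + k := by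
      have := finrank_pos (R := ℝ) (M := E)
      push_cast [Nat.cast_sub (show 1 ≤ finrank ℝ E from this)]
      ring
    rw [this]
    ring

private lemma integral_exp_neg_norm_sq_div_two :
    ∫ x : E, exp (-‖x‖ ^ 2 / 2) = (2 * π) ^ ((finrank ℝ E : ℝ) / 2) := by
  rw [show 2 * π = π / (1 / 2) by ring,
    ← GaussianFourier.integral_rexp_neg_mul_sq_norm (by norm_num)]
  congr! 3
  ring

end GaussianMoments

private lemma lintegral_stdGaussian {d : ℕ} (f : EuclideanSpace ℝ (Fin d) → ENNReal) :
    ∫⁻ ξ, f ξ ∂(stdGaussian d) =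
      ∫⁻ ξ, ENNReal.ofReal ((2 * π) ^ (-(d : ℝ) / 2) * exp (-‖ξ‖ ^ 2 / 2)) * f ξ := by
  rw [stdGaussian, lintegral_withDensity_eq_lintegral_mul_non_measurable₀ _ (by fun_prop) (by simp)]
  rfl

private lemma lintegral_comp_neg_stdGaussian {d : ℕ} (f : EuclideanSpace ℝ (Fin d) → ENNReal) :
    ∫⁻ ξ, f (-ξ) ∂(stdGaussian d) = ∫⁻ ξ, f ξ ∂(stdGaussian d) := by
  rw [lintegral_stdGaussian, lintegral_stdGaussian, ← lintegral_neg_eq_self]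
  simp

/-- The second and fourth moments of `‖ξ‖` for `ξ ~ N(0, I_d)` are `d` and `d (d + 2)`. -/
private lemma lintegral_stdGaussian_quartic (d : ℕ) {a b c : ℝ} (ha : 0 ≤ a) (hb : 0 ≤ b)
    (hc : 0 ≤ c) :
    ∫⁻ ξ, ENNReal.ofReal (a + b * ‖ξ‖ ^ 2 + c * ‖ξ‖ ^ 4) ∂(stdGaussian d) =
      ENNReal.ofReal (a + b * d + c * (d * (d + 2))) := by
  set C : ℝ := (2 * π) ^ (-(d : ℝ) / 2) with hC
  have hC0 : 0 < C := by positivity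
  have h0 := integrable_norm_pow_mul_exp (E := EuclideanSpace ℝ (Fin d)) 0
  have h2 := integrable_norm_pow_mul_exp (E := EuclideanSpace ℝ (Fin d)) 2
  have h4 := integrable_norm_pow_mul_exp (E := EuclideanSpace ℝ (Fin d)) 4
  have hZ : C * ∫ x : EuclideanSpace ℝ (Fin d), ‖x‖ ^ 0 * exp (-‖x‖ ^ 2 / 2) = 1 := by
    simp only [pow_zero, one_mul]
    rw [integral_exp_neg_norm_sq_div_two, finrank_euclideanSpace_fin, hC,
      ← rpow_add (by positivity)]
    ring_nf
    exact rpow_zero _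
  have e2 := integral_norm_pow_add_two_mul_exp (E := EuclideanSpace ℝ (Fin d)) 0
  have e4 := integral_norm_pow_add_two_mul_exp (E := EuclideanSpace ℝ (Fin d)) 2
  rw [finrank_euclideanSpace_fin] at e2 e4
  norm_num only [Nat.cast_zero, Nat.cast_ofNat, add_zero, zero_add] at e2 e4
  have hsplit : (fun ξ : EuclideanSpace ℝ (Fin d) =>
      C * exp (-‖ξ‖ ^ 2 / 2) * (a + b * ‖ξ‖ ^ 2 + c * ‖ξ‖ ^ 4)) = fun ξ =>
      C * a * (‖ξ‖ ^ 0 * exp (-‖ξ‖ ^ 2 / 2)) + C * b * (‖ξ‖ ^ 2 * exp (-‖ξ‖ ^ 2 / 2)) +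
        C * c * (‖ξ‖ ^ 4 * exp (-‖ξ‖ ^ 2 / 2)) := by
    ext ξ
    ring
  have h02 : Integrable fun ξ : EuclideanSpace ℝ (Fin d) =>
      C * a * (‖ξ‖ ^ 0 * exp (-‖ξ‖ ^ 2 / 2)) + C * b * (‖ξ‖ ^ 2 * exp (-‖ξ‖ ^ 2 / 2)) :=
    (h0.const_mul _).add (h2.const_mul _)
  rw [lintegral_stdGaussian]
  calc
    _ = ∫⁻ ξ : EuclideanSpace ℝ (Fin d), ENNReal.ofReal
        (C * exp (-‖ξ‖ ^ 2 / 2) * (a + b * ‖ξ‖ ^ 2 + c * ‖ξ‖ ^ 4)) := by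
      refine lintegral_congr fun ξ => ?_
      rw [← ENNReal.ofReal_mul (by positivity)]
    _ = ENNReal.ofReal (∫ ξ : EuclideanSpace ℝ (Fin d),
        C * exp (-‖ξ‖ ^ 2 / 2) * (a + b * ‖ξ‖ ^ 2 + c * ‖ξ‖ ^ 4)) := by
      refine (ofReal_integral_eq_lintegral_ofReal ?_ (ae_of_all _ fun ξ => ?_)).symm
      · rw [hsplit]
        exact h02.add (h4.const_mul _)
      · positivity
    _ = _ := by
      rw [hsplit, integral_add h02 (h4.const_mul _),
        integral_add (h0.const_mul _) (h2.const_mul _), integral_const_mul, integral_const_mul,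
        integral_const_mul, e4, e2]
      congr 1
      linear_combination (a + b * d + c * (d * (d + 2))) * hZ

private lemma rpow_three_halves {x : ℝ} (hx : 0 ≤ x) : x ^ ((3 : ℝ) / 2) = x * √x := by
  rw [show (3 : ℝ) / 2 = 1 + 1 / 2 by norm_num, rpow_add_of_nonneg hx (by norm_num) (by norm_num),
    rpow_one, sqrt_eq_rpow]

private lemma two_mul_add_sq_rpow_three_halves_le {e r : ℝ} (he : 0 ≤ e) (hr : 0 ≤ r) :
    (2 * (e + r ^ 2)) ^ ((3 : ℝ) / 2) ≤ 4 * (e ^ ((3 : ℝ) / 2) + r ^ 3) := by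
  have key : (e + r ^ 2) ^ ((3 : ℝ) / 2) ≤
      2 ^ ((3 : ℝ) / 2 - 1) * (e ^ ((3 : ℝ) / 2) + (r ^ 2) ^ ((3 : ℝ) / 2)) := by
    lift e to NNReal using he
    lift r to NNReal using hr
    have := NNReal.coe_le_coe.2
      (NNReal.rpow_add_le_mul_rpow_add_rpow e (r ^ 2) (p := (3 : ℝ) / 2) (by norm_num))
    push_cast at this
    exact this
  have hr3 : (r ^ 2) ^ ((3 : ℝ) / 2) = r ^ 3 := by
    rw [rpow_three_halves (by positivity), sqrt_sq hr]
    ring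
  have h4 : (2 : ℝ) ^ ((3 : ℝ) / 2) * 2 ^ ((3 : ℝ) / 2 - 1) = 4 := by
    rw [← rpow_add two_pos]
    norm_num
  rw [hr3] at key
  rw [mul_rpow two_pos.le (by positivity), ← h4, mul_assoc]
  gcongr

private lemma one_sub_exp_neg_le (t : ℝ) : 1 - exp (-t) ≤ t := by
  linarith [add_one_le_exp (-t)]

private lemma lintegral_calE_OUhalf_le {d : ℕ} (U : EuclideanSpace ℝ (Fin d) → ℝ) {L γ h : ℝ}
    (hL : 0 < L) (hγ : 0 < γ) (hh : 0 < h)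
    (z : EuclideanSpace ℝ (Fin d) × EuclideanSpace ℝ (Fin d)) :
    ∫⁻ ξ, ENNReal.ofReal (calE U L (OUhalf γ h ξ z)) ∂(stdGaussian d) ≤
      ENNReal.ofReal (calE U L z + γ * h * d) := by
  have ht : 0 < γ * h := mul_pos hγ hh
  set f : EuclideanSpace ℝ (Fin d) → ENNReal :=
    fun ξ => ENNReal.ofReal (calE U L (OUhalf γ h ξ z)) with hf
  have hcalE (w : EuclideanSpace ℝ (Fin d) × EuclideanSpace ℝ (Fin d)) : 0 ≤ calE U L w := by
    unfold calE
    positivity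
  have hmeas : Measurable f := by
    simp only [hf, calE, OUhalf]
    fun_prop
  have hc1 : exp (-(γ * h) / 2) ^ 2 ≤ 1 :=
    pow_le_one₀ (exp_pos _).le (exp_le_one_iff.2 (by linarith))
  have hs : √(1 - exp (-(γ * h))) ^ 2 ≤ γ * h := by
    rw [sq_sqrt (by simpa using ht.le)]
    exact one_sub_exp_neg_le _
  have hpt (ξ : EuclideanSpace ℝ (Fin d)) : f ξ + f (-ξ) ≤
      ENNReal.ofReal (2 * calE U L z + 2 * (γ * h) * ‖ξ‖ ^ 2 + 0 * ‖ξ‖ ^ 4) := by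
    simp only [hf]
    rw [← ENNReal.ofReal_add (hcalE _) (hcalE _)]
    refine ENNReal.ofReal_le_ofReal ?_
    have hpar := parallelogram_law_with_norm ℝ (exp (-(γ * h) / 2) • z.2)
      (√(1 - exp (-(γ * h))) • ξ)
    simp only [norm_smul, norm_of_nonneg (exp_pos _).le, norm_of_nonneg (sqrt_nonneg _)] at hpar
    simp only [calE, OUhalf, smul_neg, ← sub_eq_add_neg]
    have h1 := mul_le_mul_of_nonneg_right hc1 (sq_nonneg ‖z.2‖)
    have h2 := mul_le_mul_of_nonneg_right hs (sq_nonneg ‖ξ‖)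
    nlinarith
  have hdouble : 2 * ∫⁻ ξ, f ξ ∂(stdGaussian d) ≤
      2 * ENNReal.ofReal (calE U L z + γ * h * d) := by
    calc
      _ = ∫⁻ ξ, f ξ + f (-ξ) ∂(stdGaussian d) := by
        rw [lintegral_add_left hmeas, lintegral_comp_neg_stdGaussian, two_mul]
      _ ≤ _ := lintegral_mono hpt
      _ = _ := by
        have hz := hcalE z
        rw [lintegral_stdGaussian_quartic d (by positivity) (by positivity) le_rfl,
          ← ENNReal.ofReal_ofNat 2, ← ENNReal.ofReal_mul two_pos.le]
        congr 1
        ring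
  exact (ENNReal.mul_le_mul_iff_right two_ne_zero ENNReal.ofNat_ne_top).1 hdouble

private lemma lintegral_calE_OUhalf_rpow_le {d : ℕ} (U : EuclideanSpace ℝ (Fin d) → ℝ) {L γ h : ℝ}
    (hL : 0 < L) (hγ : 0 < γ) (hh : 0 < h)
    (z : EuclideanSpace ℝ (Fin d) × EuclideanSpace ℝ (Fin d)) :
    ∫⁻ ξ, ENNReal.ofReal (calE U L (OUhalf γ h ξ z) ^ ((3 : ℝ) / 2)) ∂(stdGaussian d) ≤
      ENNReal.ofReal (4 * (calE U L z ^ ((3 : ℝ) / 2) + 3 * (γ * h * d) ^ ((3 : ℝ) / 2))) := by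
  have ht : 0 < γ * h := mul_pos hγ hh
  have hcalE (w : EuclideanSpace ℝ (Fin d) × EuclideanSpace ℝ (Fin d)) : 0 ≤ calE U L w := by
    unfold calE
    positivity
  have hz := hcalE z
  have hc0 := (exp_pos (-(γ * h) / 2)).le
  have hc1 : exp (-(γ * h) / 2) ≤ 1 := exp_le_one_iff.2 (by linarith)
  set r := √(γ * h) with hr
  have hr2 : r ^ 2 = γ * h := sq_sqrt ht.le
  have hr0 : 0 ≤ r := sqrt_nonneg _
  have hs : √(1 - exp (-(γ * h))) ≤ r := sqrt_le_sqrt (one_sub_exp_neg_le _)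
  set q := √(d : ℝ) with hq
  have hq2 : q ^ 2 = d := sq_sqrt d.cast_nonneg
  have hq0 : 0 ≤ q := sqrt_nonneg _
  have hcube (ξ : EuclideanSpace ℝ (Fin d)) :
      ‖ξ‖ ^ 3 ≤ q / 2 * ‖ξ‖ ^ 2 + q⁻¹ / 2 * ‖ξ‖ ^ 4 := by
    rcases d.eq_zero_or_pos with rfl | hd
    · simp [Subsingleton.elim ξ 0]
    · have hqpos : 0 < q := sqrt_pos.2 (by exact_mod_cast hd)
      have : q / 2 * ‖ξ‖ ^ 2 + q⁻¹ / 2 * ‖ξ‖ ^ 4 - ‖ξ‖ ^ 3 =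
          q⁻¹ / 2 * (‖ξ‖ * (q - ‖ξ‖)) ^ 2 := by
        field_simp
        ring
      have : 0 ≤ q⁻¹ / 2 * (‖ξ‖ * (q - ‖ξ‖)) ^ 2 := by positivity
      linarith
  have hpt (ξ : EuclideanSpace ℝ (Fin d)) : calE U L (OUhalf γ h ξ z) ^ ((3 : ℝ) / 2) ≤
      4 * calE U L z ^ ((3 : ℝ) / 2) + 4 * r ^ 3 * (q / 2) * ‖ξ‖ ^ 2 +
        4 * r ^ 3 * (q⁻¹ / 2) * ‖ξ‖ ^ 4 := by
    have hle : calE U L (OUhalf γ h ξ z) ≤ 2 * (calE U L z + (r * ‖ξ‖) ^ 2) := by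
      have hn : ‖(OUhalf γ h ξ z).2‖ ≤ ‖z.2‖ + r * ‖ξ‖ := by
        refine (norm_add_le _ _).trans ?_
        rw [norm_smul, norm_smul, norm_of_nonneg hc0, norm_of_nonneg (sqrt_nonneg _)]
        gcongr
        exact mul_le_of_le_one_left (norm_nonneg _) hc1
      have hsq := pow_le_pow_left₀ (norm_nonneg _) hn 2
      have hg : 0 ≤ L⁻¹ * ‖gradient U z.1‖ ^ 2 := by positivity
      have hx : (OUhalf γ h ξ z).1 = z.1 := rfl
      unfold calE
      rw [hx]
      nlinarith [sq_nonneg (‖z.2‖ - r * ‖ξ‖)]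
    calc
      _ ≤ (2 * (calE U L z + (r * ‖ξ‖) ^ 2)) ^ ((3 : ℝ) / 2) :=
        rpow_le_rpow (hcalE _) hle (by norm_num)
      _ ≤ 4 * (calE U L z ^ ((3 : ℝ) / 2) + (r * ‖ξ‖) ^ 3) :=
        two_mul_add_sq_rpow_three_halves_le hz (by positivity)
      _ ≤ 4 * (calE U L z ^ ((3 : ℝ) / 2) +
          r ^ 3 * (q / 2 * ‖ξ‖ ^ 2 + q⁻¹ / 2 * ‖ξ‖ ^ 4)) := by
        rw [mul_pow]
        gcongr
        exact hcube ξ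
      _ = _ := by ring
  refine (lintegral_mono fun ξ => ENNReal.ofReal_le_ofReal (hpt ξ)).trans ?_
  rw [lintegral_stdGaussian_quartic d (by positivity) (by positivity) (by positivity)]
  refine ENNReal.ofReal_le_ofReal ?_
  have hd : (γ * h * d) ^ ((3 : ℝ) / 2) = r ^ 3 * q ^ 3 := by
    rw [rpow_three_halves (by positivity), sqrt_mul ht.le, ← hr, ← hq, ← hr2, ← hq2]
    ring
  have hmom : q / 2 * d + q⁻¹ / 2 * (d * (d + 2)) ≤ 3 * q ^ 3 := by
    rcases d.eq_zero_or_pos with rfl | hd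
    · simp [hq]
    · have hq1 : 1 ≤ q := one_le_sqrt.2 (by exact_mod_cast hd)
      rw [← hq2]
      have : q / 2 * q ^ 2 + q⁻¹ / 2 * (q ^ 2 * (q ^ 2 + 2)) = q ^ 3 + q := by
        field_simp
        ring
      nlinarith [mul_nonneg hq0 (mul_nonneg (sub_nonneg.2 hq1) (by linarith : 0 ≤ q + 1)),
        pow_nonneg hq0 3]
  rw [hd]
  nlinarith [mul_le_mul_of_nonneg_left hmom (pow_nonneg hr0 3)]

/-- Moment bounds for the energy-like function after a half OU step:
`𝔼 ℰ(O_{h/2}(ξ)(z)) ≤ ℰ(z) + γhd` and `𝔼 ℰ(O_{h/2}(ξ)(z))^{3/2} ≤ 4(ℰ(z)^{3/2} + 3(γhd)^{3/2})`. -/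
theorem OU_energy_moment_bounds (d : ℕ) (U : EuclideanSpace ℝ (Fin d) → ℝ)
    (hU : ContDiff ℝ 1 U) (L γ h : ℝ) (hL : 0 < L) (hγ : 0 < γ) (hh : 0 < h)
    (z : EuclideanSpace ℝ (Fin d) × EuclideanSpace ℝ (Fin d)) :
    (∫⁻ ξ, ENNReal.ofReal (calE U L (OUhalf γ h ξ z)) ∂(stdGaussian d) ≤
        ENNReal.ofReal (calE U L z + γ * h * d)) ∧
      (∫⁻ ξ, ENNReal.ofReal (calE U L (OUhalf γ h ξ z) ^ ((3 : ℝ) / 2)) ∂(stdGaussian d) ≤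
        ENNReal.ofReal (4 * (calE U L z ^ ((3 : ℝ) / 2) + 3 * (γ * h * d) ^ ((3 : ℝ) / 2)))) :=
  ⟨lintegral_calE_OUhalf_le U hL hγ hh z, lintegral_calE_OUhalf_rpow_le U hL hγ hh z⟩
end
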